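/- arXiv:2605.00301 — 5 statements merged into one kernel-verified Lean document; each statement's English description precedes it below -/
import Mathlib

section
/- There is an absolute constant $C$ such that for all reals $3 \leq x \leq y$ and every primitive set $A$ of natural numbers, $\sum_{n \in A,\ y/x \leq n \leq y} \frac{1}{n} \leq C \frac{\log x}{\sqrt{\log\log x}}$. -/
/-- A set of natural numbers is primitive if no element divides another distinct element. -/
def Primitive (A : Set ℕ) : Prop := ∀ a ∈ A, ∀ b ∈ A, a ≠ b → ¬ a ∣ b

open Finset in
theorem IsAntichain.card_le_choose_of_subset {α : Type*} [DecidableEq α] {𝒜 : Finset (Finset α)}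
    (h𝒜 : IsAntichain (· ⊆ ·) (𝒜 : Set (Finset α))) {m : Finset α} (hm : ∀ s ∈ 𝒜, s ⊆ m) :
    #𝒜 ≤ (#m).choose (#m / 2) := by
  have hback : ∀ s ∈ 𝒜, (s.subtype (· ∈ m)).map (Function.Embedding.subtype _) = s :=
    fun s hs => Finset.subtype_map_of_mem (hm s hs)
  have hinj : Set.InjOn (fun s : Finset α => s.subtype (· ∈ m)) (𝒜 : Set (Finset α)) := by
    intro s hs t ht hst
    rw [← hback s hs, ← hback t ht]
    exact congrArg _ hst
  have hanti : IsAntichain (· ⊆ ·)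
      ((𝒜.image fun s => s.subtype (· ∈ m) : Finset (Finset {x // x ∈ m})) :
        Set (Finset {x // x ∈ m})) := by
    intro s hs t ht hne hst
    simp only [coe_image, Set.mem_image, mem_coe] at hs ht
    obtain ⟨s, hs, rfl⟩ := hs
    obtain ⟨t, ht, rfl⟩ := ht
    refine h𝒜 hs ht (fun h => hne (by rw [h])) ?_
    rw [← hback s hs, ← hback t ht]
    exact Finset.map_subset_map.2 hst
  have := hanti.sperner
  rwa [card_image_of_injOn hinj, Fintype.card_coe] at this

theorem Nat.two_mul_add_one_mul_centralBinom_sq_le (k : ℕ) :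
    (2 * k + 1) * k.centralBinom ^ 2 ≤ 16 ^ k := by
  induction k with
  | zero => simp
  | succ k ih =>
    have h := Nat.succ_mul_centralBinom_succ k
    refine Nat.le_of_mul_le_mul_left (c := (k + 1) ^ 2) ?_ (by positivity)
    calc (k + 1) ^ 2 * ((2 * (k + 1) + 1) * (k + 1).centralBinom ^ 2)
        = (2 * k + 3) * ((k + 1) * (k + 1).centralBinom) ^ 2 := by ring
      _ = 4 * ((2 * k + 3) * (2 * k + 1)) * ((2 * k + 1) * k.centralBinom ^ 2) := by
          rw [h]; ring
      _ ≤ 4 * (4 * (k + 1) ^ 2) * 16 ^ k :=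
          Nat.mul_le_mul (Nat.mul_le_mul_left 4 (by nlinarith)) ih
      _ = (k + 1) ^ 2 * 16 ^ (k + 1) := by ring

theorem Nat.succ_mul_choose_half_sq_le (n : ℕ) : (n + 1) * n.choose (n / 2) ^ 2 ≤ 4 ^ n := by
  obtain ⟨k, rfl | rfl⟩ := Nat.even_or_odd' n
  · have := Nat.two_mul_add_one_mul_centralBinom_sq_le k
    rw [Nat.centralBinom_eq_two_mul_choose] at this
    rw [Nat.mul_div_cancel_left k (by norm_num), pow_mul]
    exact this
  · have h1 : 2 * (2 * k + 1).choose k = (k + 1).centralBinom := by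
      rw [Nat.centralBinom_eq_two_mul_choose, mul_add, mul_one, Nat.choose_succ_succ,
        Nat.choose_symm_half, two_mul]
    have h2 := Nat.two_mul_add_one_mul_centralBinom_sq_le (k + 1)
    rw [← h1] at h2
    have h3 : (2 * k + 1) / 2 = k := by omega
    rw [h3]
    have h4 : (4 : ℕ) ^ (2 * k + 1) * 4 = 16 ^ (k + 1) := by
      rw [← pow_succ, show (16 : ℕ) = 4 ^ 2 by norm_num, ← pow_mul]; ring_nf
    nlinarith

open Finset in
theorem Finset.sum_prod_Icc_eq {α : Type*} [DecidableEq α] (r : α → ℝ) {s P : Finset α}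
    (h : s ⊆ P) : ∑ m ∈ Icc s P, ∏ i ∈ m, r i = (∏ i ∈ s, r i) * ∏ i ∈ P \ s, (1 + r i) := by
  have hd : ∀ t ∈ (P \ s).powerset, Disjoint s t := fun t ht =>
    disjoint_of_subset_right (mem_powerset.1 ht) disjoint_sdiff
  rw [Icc_eq_image_powerset h, sum_image, prod_one_add, mul_sum]
  · exact sum_congr rfl fun t ht => prod_union (hd t ht)
  · intro t ht u hu htu
    have h1 := union_sdiff_cancel_left (hd t ht)
    rw [← h1, ← union_sdiff_cancel_left (hd u hu)]
    exact congrArg (· \ s) htu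

open Finset in
/-- Averaging `1 / (#m + 1)` over subsets of `P` against a product weight. -/
theorem Finset.sum_mul_sum_prod_div_card_add_one_le {α : Type*} [DecidableEq α] (v : α → ℝ)
    (P : Finset α) {B : ℝ} (hB0 : 0 ≤ B) (h0 : ∀ i ∈ P, 0 ≤ v i) (hB : ∀ i ∈ P, v i ≤ B) :
    (∑ i ∈ P, v i) * ∑ m ∈ P.powerset, (∏ i ∈ m, v i) / (#m + 1) ≤
      (1 + B) * ∏ i ∈ P, (1 + v i) := by
  have hnn : ∀ m ∈ P.powerset, 0 ≤ ∏ i ∈ m, v i := fun m hm =>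
    prod_nonneg fun i hi => h0 i (mem_powerset.1 hm hi)
  have key : ∑ m ∈ P.powerset, ∑ i ∈ P \ m, v i * ((∏ i ∈ m, v i) / (#m + 1)) =
      ∑ m ∈ P.powerset, ∑ i ∈ m, (∏ i ∈ m, v i) / #m := by
    rw [sum_sigma', sum_sigma']
    refine sum_nbij' (fun x => ⟨insert x.2 x.1, x.2⟩) (fun x => ⟨x.1.erase x.2, x.2⟩)
      ?_ ?_ ?_ ?_ ?_
    · rintro ⟨m, i⟩ h
      simp only [mem_sigma, mem_powerset, mem_sdiff] at h ⊢
      exact ⟨insert_subset h.2.1 h.1, mem_insert_self _ _⟩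
    · rintro ⟨m, i⟩ h
      simp only [mem_sigma, mem_powerset, mem_sdiff] at h ⊢
      exact ⟨(erase_subset _ _).trans h.1, h.1 h.2, notMem_erase _ _⟩
    · rintro ⟨m, i⟩ h
      simp only [mem_sigma, mem_powerset, mem_sdiff] at h
      simp [erase_insert h.2.2]
    · rintro ⟨m, i⟩ h
      simp only [mem_sigma, mem_powerset] at h
      simp [insert_erase h.2]
    · rintro ⟨m, i⟩ h
      simp only [mem_sigma, mem_powerset, mem_sdiff] at h
      simp only [prod_insert h.2.2, card_insert_of_notMem h.2.2]
      push_cast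
      ring
  have hright : ∑ m ∈ P.powerset, ∑ i ∈ m, (∏ i ∈ m, v i) / #m ≤ ∏ i ∈ P, (1 + v i) := by
    rw [prod_one_add]
    refine sum_le_sum fun m hm => ?_
    rw [sum_const, nsmul_eq_mul]
    rcases m.eq_empty_or_nonempty with rfl | hne
    · simp
    · have : (#m : ℝ) ≠ 0 := by exact_mod_cast hne.card_pos.ne'
      exact (mul_div_cancel₀ _ this).le
  have hleft : ∀ m ∈ P.powerset, (∑ i ∈ P, v i) * ((∏ i ∈ m, v i) / (#m + 1)) ≤
      ∑ i ∈ P \ m, v i * ((∏ i ∈ m, v i) / (#m + 1)) + B * ∏ i ∈ m, v i := by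
    intro m hm
    have hmP := mem_powerset.1 hm
    have hm1 : (0 : ℝ) < #m + 1 := by positivity
    have h1 : ∑ i ∈ m, v i ≤ B * (#m + 1) := by
      calc ∑ i ∈ m, v i ≤ ∑ i ∈ m, B := sum_le_sum fun i hi => hB i (hmP hi)
        _ = B * #m := by rw [sum_const, nsmul_eq_mul, mul_comm]
        _ ≤ B * (#m + 1) := by gcongr; linarith
    rw [← sum_mul, ← sum_sdiff hmP, add_mul]
    refine add_le_add_right ?_ _
    calc (∑ i ∈ m, v i) * ((∏ i ∈ m, v i) / (#m + 1))
        ≤ (B * (#m + 1)) * ((∏ i ∈ m, v i) / (#m + 1)) := by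
          have := hnn m hm
          gcongr
      _ = B * ∏ i ∈ m, v i := by field_simp
  calc (∑ i ∈ P, v i) * ∑ m ∈ P.powerset, (∏ i ∈ m, v i) / (#m + 1)
      ≤ ∑ m ∈ P.powerset,
        (∑ i ∈ P \ m, v i * ((∏ i ∈ m, v i) / (#m + 1)) + B * ∏ i ∈ m, v i) := by
        rw [mul_sum]; exact sum_le_sum hleft
    _ ≤ ∏ i ∈ P, (1 + v i) + B * ∏ i ∈ P, (1 + v i) := by
        rw [sum_add_distrib, key, ← mul_sum, ← prod_one_add]
        gcongr
    _ = _ := by ring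

open Finset in
/-- Sperner's theorem for product measures. -/
theorem IsAntichain.sum_prod_mul_prod_sdiff_le {α : Type*} [DecidableEq α]
    {𝒜 : Finset (Finset α)} (h𝒜 : IsAntichain (· ⊆ ·) (𝒜 : Set (Finset α))) {P : Finset α}
    (hP : ∀ s ∈ 𝒜, s ⊆ P) (r : α → ℝ) {B : ℝ} (hB0 : 0 ≤ B) (h0 : ∀ i ∈ P, 0 ≤ r i)
    (hB : ∀ i ∈ P, 2 * r i ≤ B) (hpos : 0 < ∑ i ∈ P, 2 * r i) :
    ∑ s ∈ 𝒜, (∏ i ∈ s, r i) * ∏ i ∈ P \ s, (1 + r i) ≤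
      √((1 + B) / ∑ i ∈ P, 2 * r i) * ∏ i ∈ P, (1 + 2 * r i) := by
  set V := ∑ i ∈ P, 2 * r i with hV
  set D := ∏ i ∈ P, (1 + 2 * r i) with hD
  have hD0 : 0 ≤ D := prod_nonneg fun i hi => by linarith [h0 i hi]
  have hw : ∀ m ∈ P.powerset, 0 ≤ ∏ i ∈ m, r i := fun m hm =>
    prod_nonneg fun i hi => h0 i (mem_powerset.1 hm hi)
  have hW : ∀ m : Finset α, ∏ i ∈ m, 2 * r i = 2 ^ #m * ∏ i ∈ m, r i := fun m => by
    rw [prod_mul_distrib, prod_const]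
  have hcount : ∀ m ∈ P.powerset, (#(𝒜.filter (· ⊆ m)) : ℝ) ≤ 2 ^ #m / √(#m + 1) := by
    intro m _
    have h1 : #(𝒜.filter (· ⊆ m)) ≤ (#m).choose (#m / 2) :=
      IsAntichain.card_le_choose_of_subset
        (h𝒜.subset (coe_subset.2 (filter_subset _ _))) (fun s hs => (mem_filter.1 hs).2)
    have h2 : ((#m : ℝ) + 1) * ((#m).choose (#m / 2) : ℝ) ^ 2 ≤ 4 ^ #m := by
      exact_mod_cast Nat.succ_mul_choose_half_sq_le #m
    rw [le_div_iff₀ (by positivity)]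
    calc (#(𝒜.filter (· ⊆ m)) : ℝ) * √(#m + 1)
        ≤ ((#m).choose (#m / 2) : ℝ) * √(#m + 1) := by gcongr
      _ ≤ 2 ^ #m := by
        refine abs_le_of_sq_le_sq' ?_ (by positivity) |>.2
        rw [mul_pow, Real.sq_sqrt (by positivity), ← pow_mul, mul_comm #m 2, pow_mul]
        norm_num
        linarith
  calc ∑ s ∈ 𝒜, (∏ i ∈ s, r i) * ∏ i ∈ P \ s, (1 + r i)
      = ∑ s ∈ 𝒜, ∑ m ∈ P.powerset with s ⊆ m, ∏ i ∈ m, r i := by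
        refine sum_congr rfl fun s hs => ?_
        rw [← sum_prod_Icc_eq r (hP s hs)]
        refine sum_congr ?_ fun _ _ => rfl
        ext m
        simp [and_comm]
    _ = ∑ m ∈ P.powerset, (#(𝒜.filter (· ⊆ m)) : ℝ) * ∏ i ∈ m, r i := by
        simp_rw [sum_filter]
        rw [sum_comm]
        simp_rw [← sum_filter, sum_const, nsmul_eq_mul]
    _ ≤ ∑ m ∈ P.powerset, √(∏ i ∈ m, 2 * r i) * √((∏ i ∈ m, 2 * r i) / (#m + 1)) := by
        refine sum_le_sum fun m hm => ?_
        have h1 : 0 ≤ ∏ i ∈ m, 2 * r i := by rw [hW]; have := hw m hm; positivity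
        rw [Real.sqrt_div h1, ← mul_div_assoc, Real.mul_self_sqrt h1, hW]
        calc _ ≤ 2 ^ #m / √(#m + 1) * ∏ i ∈ m, r i := by
              have := hw m hm
              gcongr
              exact hcount m hm
          _ = _ := by ring
    _ ≤ √(∑ m ∈ P.powerset, ∏ i ∈ m, 2 * r i) *
          √(∑ m ∈ P.powerset, (∏ i ∈ m, 2 * r i) / (#m + 1)) := by
        have h1 : ∀ m ∈ P.powerset, 0 ≤ ∏ i ∈ m, 2 * r i := fun m hm => by
          rw [hW]; have := hw m hm; positivity
        refine (Real.sum_mul_le_sqrt_mul_sqrt _ _ _).trans_eq ?_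
        congr 2
        · exact sum_congr rfl fun m hm => Real.sq_sqrt (h1 m hm)
        · exact sum_congr rfl fun m hm => Real.sq_sqrt (div_nonneg (h1 m hm) (by positivity))
    _ ≤ √D * √((1 + B) / V * D) := by
        rw [hD, prod_one_add]
        gcongr
        rw [← prod_one_add, div_mul_eq_mul_div, le_div_iff₀ hpos, mul_comm]
        exact sum_mul_sum_prod_div_card_add_one_le (fun i => 2 * r i) P hB0
          (fun i hi => by linarith [h0 i hi]) hB
    _ = √((1 + B) / V) * D := by
        rw [Real.sqrt_mul' _ hD0, mul_left_comm, Real.mul_self_sqrt hD0]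

theorem Finset.sum_Icc_rpow_sub_one_le {δ : ℝ} (h0 : 0 < δ) (h1 : δ ≤ 1) (N : ℕ) :
    ∑ n ∈ Finset.Icc 1 N, (n : ℝ) ^ (δ - 1) ≤ (N : ℝ) ^ δ / δ := by
  induction N with
  | zero => simp; positivity
  | succ N ih =>
    rw [Finset.sum_Icc_succ_top (by omega)]
    have hpos : (0 : ℝ) < (N + 1 : ℕ) := by positivity
    have hb := rpow_one_add_le_one_add_mul_self (s := -(1 / ((N + 1 : ℕ) : ℝ))) (p := δ)
      (by rw [neg_le_neg_iff, div_le_one hpos]; push_cast; linarith [N.cast_nonneg (α := ℝ)])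
      h0.le h1
    have he : (N : ℝ) = (N + 1 : ℕ) * (1 + -(1 / ((N + 1 : ℕ) : ℝ))) := by
      field_simp; push_cast; ring
    have hstep : (N : ℝ) ^ δ ≤ ((N + 1 : ℕ) : ℝ) ^ δ - δ * ((N + 1 : ℕ) : ℝ) ^ (δ - 1) := by
      have hnn : 0 ≤ 1 + -(1 / ((N + 1 : ℕ) : ℝ)) := by
        have : 1 / ((N + 1 : ℕ) : ℝ) ≤ 1 := by
          rw [div_le_one hpos]; push_cast; linarith [N.cast_nonneg (α := ℝ)]
        linarith
      rw [he, Real.mul_rpow hpos.le hnn, Real.rpow_sub_one hpos.ne']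
      calc _ ≤ ((N + 1 : ℕ) : ℝ) ^ δ * (1 + δ * -(1 / ((N + 1 : ℕ) : ℝ))) := by gcongr
        _ = _ := by ring
    calc _ ≤ (N : ℝ) ^ δ / δ + ((N + 1 : ℕ) : ℝ) ^ (δ - 1) := by gcongr
      _ ≤ (((N + 1 : ℕ) : ℝ) ^ δ - δ * ((N + 1 : ℕ) : ℝ) ^ (δ - 1)) / δ
          + ((N + 1 : ℕ) : ℝ) ^ (δ - 1) := by gcongr
      _ = _ := by field_simp; ring

theorem Finset.sum_Icc_rpow_neg_one_sub_le {δ : ℝ} (h0 : 0 < δ) (h1 : δ ≤ 1) (N : ℕ) :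
    ∑ n ∈ Finset.Icc 1 N, (n : ℝ) ^ (-1 - δ) ≤ 1 + 1 / δ := by
  suffices h : ∑ n ∈ Finset.Icc 1 (N + 1), (n : ℝ) ^ (-1 - δ) ≤
      1 + (1 - ((N + 1 : ℕ) : ℝ) ^ (-δ)) / δ by
    refine (Finset.sum_le_sum_of_subset_of_nonneg
      (Finset.Icc_subset_Icc_right (Nat.le_succ N)) fun _ _ _ => by positivity).trans (h.trans ?_)
    gcongr
    have : 0 ≤ ((N + 1 : ℕ) : ℝ) ^ (-δ) := by positivity
    linarith
  induction N with
  | zero => simp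
  | succ N ih =>
    rw [Finset.sum_Icc_succ_top (by omega)]
    set a : ℝ := ((N + 1 : ℕ) : ℝ) with ha
    have ha0 : 0 < a := by positivity
    have hb : ((N + 1 + 1 : ℕ) : ℝ) = a + 1 := by push_cast [ha]; ring
    rw [hb]
    have hstep : (a + 1) ^ (-δ) * (1 + δ / (a + 1)) ≤ a ^ (-δ) := by
      have hbern := rpow_one_add_le_one_add_mul_self (s := -(1 / (a + 1))) (p := δ)
        (by rw [neg_le_neg_iff, div_le_one (by positivity)]; linarith) h0.le h1
      have he : a = (a + 1) * (1 + -(1 / (a + 1))) := by field_simp; ring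
      have hlt : 0 < 1 + -(1 / (a + 1)) := by
        have : 1 / (a + 1) < 1 := by rw [div_lt_one (by positivity)]; linarith
        linarith
      conv_rhs => rw [he, Real.mul_rpow (by positivity) hlt.le, Real.rpow_neg hlt.le]
      gcongr
      rw [le_inv_comm₀ (by positivity) (by positivity)]
      refine hbern.trans ?_
      rw [← one_div, le_div_iff₀ (by positivity)]
      have : 0 ≤ (δ / (a + 1)) ^ 2 := by positivity
      calc _ = 1 - (δ / (a + 1)) ^ 2 := by ring
        _ ≤ 1 := by linarith
    have hr : (a + 1) ^ (-1 - δ) = (a + 1) ^ (-δ) / (a + 1) := by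
      rw [← Real.rpow_sub_one (by positivity)]; ring_nf
    calc _ ≤ 1 + (1 - a ^ (-δ)) / δ + (a + 1) ^ (-1 - δ) := by gcongr
      _ ≤ 1 + (1 - (a + 1) ^ (-δ) * (1 + δ / (a + 1))) / δ + (a + 1) ^ (-1 - δ) := by gcongr
      _ = _ := by rw [hr]; field_simp; ring

theorem Nat.sum_primesLE_log_div_le (N : ℕ) :
    ∑ p ∈ N.primesLE, Real.log p / p ≤ 2 * Real.log N := by
  rcases N.eq_zero_or_pos with rfl | hN
  · simp
  have h1 : ∀ n ∈ Finset.Ioc 0 N,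
      ∑ p ∈ N.primesLE with p ∣ n, Real.log p ≤ Real.log N := by
    intro n hn
    rw [Finset.mem_Ioc] at hn
    rw [← Real.log_prod fun p hp => by
      have := (Nat.mem_primesLE.1 (Finset.mem_filter.1 hp).1).2.ne_zero
      exact_mod_cast this]
    have hd : ∏ p ∈ N.primesLE with p ∣ n, p ∣ n :=
      Finset.prod_primes_dvd n
        (fun p hp => (Nat.mem_primesLE.1 (Finset.mem_filter.1 hp).1).2.prime)
        (fun p hp => (Finset.mem_filter.1 hp).2)
    have hle := (Nat.le_of_dvd hn.1 hd).trans hn.2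
    have hpos := Nat.pos_of_dvd_of_pos hd hn.1
    rw [← Nat.cast_prod]
    exact Real.log_le_log (by exact_mod_cast hpos) (by exact_mod_cast hle)
  have h2 : ∑ p ∈ N.primesLE, Real.log p * (N / p : ℕ) ≤ N * Real.log N := by
    calc ∑ p ∈ N.primesLE, Real.log p * (N / p : ℕ)
        = ∑ n ∈ Finset.Ioc 0 N, ∑ p ∈ N.primesLE with p ∣ n, Real.log p := by
          simp_rw [Finset.sum_filter]
          rw [Finset.sum_comm]
          refine Finset.sum_congr rfl fun p _ => ?_
          rw [← Finset.sum_filter, Finset.sum_const, Nat.Ioc_filter_dvd_card_eq_div,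
            nsmul_eq_mul, mul_comm]
      _ ≤ ∑ n ∈ Finset.Ioc 0 N, Real.log N := Finset.sum_le_sum h1
      _ = N * Real.log N := by simp
  have h3 : ∀ p ∈ N.primesLE, (N : ℝ) / 2 * (Real.log p / p) ≤ Real.log p * (N / p : ℕ) := by
    intro p hp
    obtain ⟨hpN, hpp⟩ := Nat.mem_primesLE.1 hp
    have hp0 : (0 : ℝ) < p := by exact_mod_cast hpp.pos
    have hlog : 0 ≤ Real.log p := Real.log_natCast_nonneg p
    have hdiv : (N : ℝ) ≤ 2 * p * (N / p : ℕ) := by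
      have h4 : 1 ≤ N / p := Nat.div_pos hpN hpp.pos
      have h5 := Nat.div_add_mod N p
      have h6 := Nat.mod_lt N hpp.pos
      have : N ≤ 2 * p * (N / p) := by nlinarith
      exact_mod_cast this
    calc (N : ℝ) / 2 * (Real.log p / p) ≤ (2 * p * (N / p : ℕ)) / 2 * (Real.log p / p) := by
          gcongr
      _ = _ := by field_simp
  have h4 := (Finset.sum_le_sum h3).trans h2
  rw [← Finset.mul_sum] at h4
  have hN' : (0 : ℝ) < N := by exact_mod_cast hN
  nlinarith

theorem Nat.primeFactors_prod_primesLE {N : ℕ} {T : Finset ℕ} (hT : T ⊆ N.primesLE) :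
    (∏ p ∈ T, p).primeFactors = T :=
  Nat.primeFactors_prod fun _ hp => (Nat.mem_primesLE.1 (hT hp)).2

theorem Nat.prod_primesLE_pos {N : ℕ} {T : Finset ℕ} (hT : T ⊆ N.primesLE) :
    0 < ∏ p ∈ T, p :=
  Finset.prod_pos fun _ hp => (Nat.mem_primesLE.1 (hT hp)).2.pos

theorem Nat.factorization_prod_primesLE {N : ℕ} {T : Finset ℕ} (hT : T ⊆ N.primesLE) (q : ℕ) :
    (∏ p ∈ T, p).factorization q = if q ∈ T then 1 else 0 := by
  rw [Nat.factorization_prod fun p hp => (Nat.mem_primesLE.1 (hT hp)).2.ne_zero,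
    Finsupp.finsetSum_apply, Finset.sum_congr rfl fun p hp => by
      rw [(Nat.mem_primesLE.1 (hT hp)).2.factorization, Finsupp.single_apply]]
  simp

theorem Nat.prod_one_add_rpow_primesLE_le {δ : ℝ} (h0 : 0 < δ) (h1 : δ ≤ 1) (N : ℕ) :
    ∏ p ∈ N.primesLE, (1 + (p : ℝ) ^ (-1 - δ)) ≤ 1 + 1 / δ := by
  rw [Finset.prod_one_add]
  refine le_trans ?_ (Finset.sum_Icc_rpow_neg_one_sub_le h0 h1 (∏ p ∈ N.primesLE, p))
  have hinj : Set.InjOn (fun T : Finset ℕ => ∏ p ∈ T, p) (N.primesLE.powerset : Set _) := by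
    intro T hT U hU h
    rw [Finset.mem_coe, Finset.mem_powerset] at hT hU
    rw [← Nat.primeFactors_prod_primesLE hT, ← Nat.primeFactors_prod_primesLE hU]
    exact congrArg _ h
  calc ∑ T ∈ N.primesLE.powerset, ∏ p ∈ T, (p : ℝ) ^ (-1 - δ)
      = ∑ n ∈ N.primesLE.powerset.image (fun T => ∏ p ∈ T, p), (n : ℝ) ^ (-1 - δ) := by
        rw [Finset.sum_image hinj]
        refine Finset.sum_congr rfl fun T _ => ?_
        rw [Nat.cast_prod, Real.finsetProd_rpow _ _ fun p _ => p.cast_nonneg]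
    _ ≤ _ := by
        refine Finset.sum_le_sum_of_subset_of_nonneg ?_ fun _ _ _ => by positivity
        intro n hn
        obtain ⟨T, hT, rfl⟩ := Finset.mem_image.1 hn
        rw [Finset.mem_powerset] at hT
        exact Finset.mem_Icc.2 ⟨Nat.prod_primesLE_pos hT,
          Nat.le_of_dvd (Nat.prod_primesLE_pos subset_rfl) (Finset.prod_dvd_prod_of_subset _ _ _ hT)⟩

theorem Nat.prod_one_add_rpow_sub_one_primesLE_le {δ : ℝ} (h0 : 0 < δ) (h1 : δ ≤ 1) {N : ℕ}
    (hN : δ * Real.log N ≤ 1) :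
    ∏ p ∈ N.primesLE, (1 + (p : ℝ) ^ (δ - 1)) ≤ Real.exp 6 * (1 + 1 / δ) := by
  have key : ∀ p ∈ N.primesLE, 1 + (p : ℝ) ^ (δ - 1) ≤
      Real.exp (3 * δ * (Real.log p / p)) * (1 + (p : ℝ) ^ (-1 - δ)) := by
    intro p hp
    obtain ⟨hpN, hpp⟩ := Nat.mem_primesLE.1 hp
    have hp0 : (0 : ℝ) < p := by exact_mod_cast hpp.pos
    have hlog : 0 ≤ Real.log p := Real.log_natCast_nonneg p
    set t := δ * Real.log p with ht
    have ht0 : 0 ≤ t := by positivity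
    have ht1 : t ≤ 1 := hN.trans' <| by
      rw [ht]; gcongr
    have hA : (p : ℝ) ^ (δ - 1) = Real.exp t / p := by
      rw [Real.rpow_sub_one hp0.ne', Real.rpow_def_of_pos hp0, mul_comm]
    have hB : (p : ℝ) ^ (-1 - δ) = Real.exp (-t) / p := by
      rw [show -1 - δ = -δ - 1 by ring, Real.rpow_sub_one hp0.ne', Real.rpow_def_of_pos hp0, ht]
      ring_nf
    have hd : Real.exp t - Real.exp (-t) ≤ 3 * t := by
      have e1 := Real.abs_exp_sub_one_le (x := t) (by rwa [abs_of_nonneg ht0])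
      rw [abs_of_nonneg ht0] at e1
      have e2 := le_of_abs_le e1
      have e3 := Real.add_one_le_exp (-t)
      linarith
    have hd' : (p : ℝ) ^ (δ - 1) - (p : ℝ) ^ (-1 - δ) ≤ 3 * δ * (Real.log p / p) := by
      rw [hA, hB, ← sub_div, show 3 * δ * (Real.log p / p) = 3 * t / p by rw [ht]; ring]
      gcongr
    have hb0 : 0 ≤ (p : ℝ) ^ (-1 - δ) := by positivity
    have hc0 : 0 ≤ 3 * δ * (Real.log p / p) := by positivity
    calc _ ≤ (3 * δ * (Real.log p / p) + 1) * (1 + (p : ℝ) ^ (-1 - δ)) := by nlinarith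
      _ ≤ _ := by gcongr; exact Real.add_one_le_exp _
  calc _ ≤ ∏ p ∈ N.primesLE, (Real.exp (3 * δ * (Real.log p / p)) * (1 + (p : ℝ) ^ (-1 - δ))) :=
        Finset.prod_le_prod (fun _ _ => by positivity) key
    _ = Real.exp (3 * δ * ∑ p ∈ N.primesLE, Real.log p / p) *
          ∏ p ∈ N.primesLE, (1 + (p : ℝ) ^ (-1 - δ)) := by
        rw [Finset.prod_mul_distrib, ← Real.exp_sum, Finset.mul_sum]
    _ ≤ _ := by
        have := Nat.prod_one_add_rpow_primesLE_le h0 h1 N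
        gcongr
        have := Nat.sum_primesLE_log_div_le N
        nlinarith

theorem Nat.log_succ_le_two_mul_sum_inv_prod_primes (N : ℕ) :
    Real.log (N + 1) ≤ 2 * ∑ T ∈ N.primesLE.powerset with ∏ p ∈ T, p ≤ N,
      ((∏ p ∈ T, p : ℕ) : ℝ)⁻¹ := by
  have hharm : Real.log (N + 1) ≤ ∑ n ∈ Finset.Icc 1 N, (n : ℝ)⁻¹ := by
    have := log_add_one_le_harmonic N
    rw [harmonic_eq_sum_Icc] at this
    push_cast at this
    exact this
  have hsq : ∑ b ∈ Finset.Icc 1 N, ((b : ℝ) ^ 2)⁻¹ ≤ 2 := by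
    refine le_trans (le_of_eq ?_) ((Finset.sum_Icc_rpow_neg_one_sub_le one_pos le_rfl N).trans
      (by norm_num))
    refine Finset.sum_congr rfl fun b _ => ?_
    rw [show (-1 - 1 : ℝ) = -(2 : ℕ) by norm_num, Real.rpow_neg b.cast_nonneg, Real.rpow_natCast]
  set 𝒯 := N.primesLE.powerset.filter fun T => ∏ p ∈ T, p ≤ N with h𝒯
  have hsub : Finset.Icc 1 N ⊆
      (Finset.Icc 1 N ×ˢ 𝒯).image fun x => x.1 ^ 2 * ∏ p ∈ x.2, p := by
    intro n hn
    obtain ⟨hn1, hnN⟩ := Finset.mem_Icc.1 hn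
    obtain ⟨a, b, hab, ha⟩ := Nat.sq_mul_squarefree n
    have ha0 : 0 < a := Nat.pos_of_ne_zero ha.ne_zero
    have hb0 : 0 < b := Nat.pos_of_ne_zero (by rintro rfl; simp at hab; omega)
    have haN : a ≤ N := (Nat.le_of_dvd hn1 ⟨b ^ 2, by rw [← hab, mul_comm]⟩).trans hnN
    have hbN : b ≤ N := (Nat.le_of_dvd hn1 ⟨b * a, by rw [← hab]; ring⟩).trans hnN
    refine Finset.mem_image.2 ⟨(b, a.primeFactors), ?_, ?_⟩
    · simp only [Finset.mem_product, Finset.mem_Icc, h𝒯, Finset.mem_filter,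
        Finset.mem_powerset, Nat.prod_primeFactors_of_squarefree ha]
      exact ⟨⟨hb0, hbN⟩, fun p hp => Nat.mem_primesLE.2
        ⟨(Nat.le_of_mem_primeFactors hp).trans haN, Nat.prime_of_mem_primeFactors hp⟩, haN⟩
    · simp only [Nat.prod_primeFactors_of_squarefree ha, hab]
  calc Real.log (N + 1) ≤ ∑ n ∈ Finset.Icc 1 N, (n : ℝ)⁻¹ := hharm
    _ ≤ ∑ n ∈ (Finset.Icc 1 N ×ˢ 𝒯).image (fun x => x.1 ^ 2 * ∏ p ∈ x.2, p), ((n : ℕ) : ℝ)⁻¹ :=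
        Finset.sum_le_sum_of_subset_of_nonneg hsub fun _ _ _ => by positivity
    _ ≤ ∑ x ∈ Finset.Icc 1 N ×ˢ 𝒯, ((x.1 ^ 2 * ∏ p ∈ x.2, p : ℕ) : ℝ)⁻¹ :=
        Finset.sum_image_le_of_nonneg fun _ _ => by positivity
    _ = (∑ b ∈ Finset.Icc 1 N, ((b : ℝ) ^ 2)⁻¹) * ∑ T ∈ 𝒯, ((∏ p ∈ T, p : ℕ) : ℝ)⁻¹ := by
        rw [Finset.sum_mul_sum, ← Finset.sum_product']
        refine Finset.sum_congr rfl fun x _ => ?_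
        rw [Nat.cast_mul, mul_inv, Nat.cast_pow]
    _ ≤ _ := by
        have : 0 ≤ ∑ T ∈ 𝒯, ((∏ p ∈ T, p : ℕ) : ℝ)⁻¹ := Finset.sum_nonneg fun _ _ => by positivity
        gcongr

theorem Nat.log_log_sub_le_sum_inv_primesLE {N : ℕ} (hN : 1 ≤ N) :
    Real.log (Real.log (N + 1) / 2) ≤ ∑ p ∈ N.primesLE, (p : ℝ)⁻¹ := by
  have hpos : 0 < Real.log (N + 1) := Real.log_pos (by
    have : (1 : ℝ) ≤ N := by exact_mod_cast hN
    linarith)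
  rw [← Real.log_exp (∑ p ∈ N.primesLE, (p : ℝ)⁻¹)]
  refine Real.log_le_log (by positivity) ?_
  have h1 : ∑ T ∈ N.primesLE.powerset with ∏ p ∈ T, p ≤ N, ((∏ p ∈ T, p : ℕ) : ℝ)⁻¹ ≤
      ∏ p ∈ N.primesLE, (1 + (p : ℝ)⁻¹) := by
    rw [Finset.prod_one_add]
    refine (Finset.sum_le_sum_of_subset_of_nonneg (Finset.filter_subset _ _)
      fun _ _ _ => by positivity).trans_eq (Finset.sum_congr rfl fun T _ => ?_)
    rw [Nat.cast_prod, Finset.prod_inv_distrib]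
  have h2 : ∏ p ∈ N.primesLE, (1 + (p : ℝ)⁻¹) ≤ Real.exp (∑ p ∈ N.primesLE, (p : ℝ)⁻¹) := by
    rw [Real.exp_sum]
    exact Finset.prod_le_prod (fun _ _ => by positivity) fun p _ => by
      rw [add_comm]; exact Real.add_one_le_exp _
  linarith [Nat.log_succ_le_two_mul_sum_inv_prod_primes N]

/-- The primes up to `N` that divide `n` to an odd power. -/
def Nat.oddPrimes (N n : ℕ) : Finset ℕ := {p ∈ N.primesLE | Odd (n.factorization p)}

theorem Nat.oddPrimes_subset (N n : ℕ) : N.oddPrimes n ⊆ N.primesLE :=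
  Finset.filter_subset _ _

theorem Nat.mem_oddPrimes {N n p : ℕ} :
    p ∈ N.oddPrimes n ↔ p ∈ N.primesLE ∧ Odd (n.factorization p) :=
  Finset.mem_filter

theorem Nat.prod_oddPrimes_dvd (N n : ℕ) : ∏ p ∈ N.oddPrimes n, p ∣ n := by
  refine Finset.prod_primes_dvd n (fun p hp => ?_) fun p hp => ?_
  · exact (Nat.mem_primesLE.1 (Nat.oddPrimes_subset N n hp)).2.prime
  · by_contra h
    have := (Nat.mem_oddPrimes.1 hp).2
    rw [Nat.factorization_eq_zero_of_not_dvd h] at this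
    simp at this

/-- The cofactor of the product of `Nat.oddPrimes`. -/
def Nat.evenCofactor (N n : ℕ) : ℕ := n / ∏ p ∈ N.oddPrimes n, p

theorem Nat.evenCofactor_mul_prod (N n : ℕ) :
    N.evenCofactor n * ∏ p ∈ N.oddPrimes n, p = n :=
  Nat.div_mul_cancel (Nat.prod_oddPrimes_dvd N n)

theorem Nat.evenCofactor_pos {N n : ℕ} (hn : 0 < n) : 0 < N.evenCofactor n :=
  Nat.pos_of_ne_zero fun h => by
    have := Nat.evenCofactor_mul_prod N n
    rw [h, zero_mul] at this
    omega

theorem Nat.factorization_mul_prod_primesLE {N k : ℕ} (hk : 0 < k) {T : Finset ℕ}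
    (hT : T ⊆ N.primesLE) (q : ℕ) :
    (k * ∏ p ∈ T, p).factorization q = k.factorization q + if q ∈ T then 1 else 0 := by
  rw [Nat.factorization_mul hk.ne' (Nat.prod_primesLE_pos hT).ne', Finsupp.add_apply,
    Nat.factorization_prod_primesLE hT]

theorem Nat.even_factorization_evenCofactor {N n : ℕ} (hn : 0 < n) {p : ℕ}
    (hp : p ∈ N.primesLE) : Even ((N.evenCofactor n).factorization p) := by
  have h := Nat.factorization_mul_prod_primesLE (N := N) (Nat.evenCofactor_pos (N := N) hn)
    (Nat.oddPrimes_subset N n) p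
  rw [Nat.evenCofactor_mul_prod] at h
  by_cases hodd : Odd (n.factorization p)
  · rw [if_pos (Nat.mem_oddPrimes.2 ⟨hp, hodd⟩)] at h
    rw [h] at hodd
    by_contra hc
    rw [Nat.not_even_iff_odd] at hc
    exact Nat.not_odd_iff_even.2 (hc.add_odd odd_one) hodd
  · rw [if_neg (fun hc => hodd (Nat.mem_oddPrimes.1 hc).2), add_zero] at h
    rwa [← h, ← Nat.not_odd_iff_even]

theorem Nat.oddPrimes_mul_prod {N k : ℕ} (hk : 0 < k)
    (heven : ∀ p ∈ N.primesLE, Even (k.factorization p)) {T : Finset ℕ}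
    (hT : T ⊆ N.primesLE) : N.oddPrimes (k * ∏ p ∈ T, p) = T := by
  ext p
  rw [Nat.mem_oddPrimes, Nat.factorization_mul_prod_primesLE hk hT]
  constructor
  · rintro ⟨hp, hodd⟩
    by_contra h
    rw [if_neg h, add_zero] at hodd
    exact Nat.not_odd_iff_even.2 (heven p hp) hodd
  · intro hp
    refine ⟨hT hp, ?_⟩
    rw [if_pos hp]
    exact (heven p (hT hp)).add_one

theorem Nat.sum_rpow_sub_one_mul_log_le {δ : ℝ} (h0 : 0 < δ) (h1 : δ ≤ 1) {N Y : ℕ}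
    (K : Finset ℕ) (hK : ∀ k ∈ K, 0 < k ∧ k ≤ Y ∧ ∀ p ∈ N.primesLE, Even (k.factorization p)) :
    (∑ k ∈ K, (k : ℝ) ^ (δ - 1)) * Real.log (N + 1) ≤ 2 * ((Y * N : ℕ) : ℝ) ^ δ / δ := by
  set 𝒯 := N.primesLE.powerset.filter fun T => ∏ p ∈ T, p ≤ N with h𝒯
  have hmem : ∀ T ∈ 𝒯, T ⊆ N.primesLE ∧ ∏ p ∈ T, p ≤ N := fun T hT => by
    rwa [h𝒯, Finset.mem_filter, Finset.mem_powerset] at hT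
  have hinj : Set.InjOn (fun x : ℕ × Finset ℕ => x.1 * ∏ p ∈ x.2, p) (K ×ˢ 𝒯 : Finset _) := by
    rintro ⟨k, T⟩ hx ⟨l, U⟩ hy h
    obtain ⟨hk, hT⟩ := Finset.mem_product.1 (Finset.mem_coe.1 hx)
    obtain ⟨hl, hU⟩ := Finset.mem_product.1 (Finset.mem_coe.1 hy)
    obtain ⟨hT, -⟩ := hmem T hT
    obtain ⟨hU, -⟩ := hmem U hU
    simp only at h hk hl
    have hTU : T = U := by
      rw [← Nat.oddPrimes_mul_prod (hK k hk).1 (hK k hk).2.2 hT, h,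
        Nat.oddPrimes_mul_prod (hK l hl).1 (hK l hl).2.2 hU]
    subst hTU
    rw [Nat.eq_of_mul_eq_mul_right (Nat.prod_primesLE_pos hT) h]
  have hprod : (∑ k ∈ K, (k : ℝ) ^ (δ - 1)) * ∑ T ∈ 𝒯, ((∏ p ∈ T, p : ℕ) : ℝ)⁻¹ ≤
      ((Y * N : ℕ) : ℝ) ^ δ / δ := by
    calc (∑ k ∈ K, (k : ℝ) ^ (δ - 1)) * ∑ T ∈ 𝒯, ((∏ p ∈ T, p : ℕ) : ℝ)⁻¹
        ≤ (∑ k ∈ K, (k : ℝ) ^ (δ - 1)) * ∑ T ∈ 𝒯, ((∏ p ∈ T, p : ℕ) : ℝ) ^ (δ - 1) := by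
          refine mul_le_mul_of_nonneg_left (Finset.sum_le_sum fun T hT => ?_)
            (Finset.sum_nonneg fun _ _ => by positivity)
          rw [← Real.rpow_neg_one]
          refine Real.rpow_le_rpow_of_exponent_le ?_ (by linarith)
          exact_mod_cast Nat.prod_primesLE_pos (hmem T hT).1
      _ = ∑ n ∈ (K ×ˢ 𝒯).image (fun x => x.1 * ∏ p ∈ x.2, p), ((n : ℕ) : ℝ) ^ (δ - 1) := by
          rw [Finset.sum_image hinj, Finset.sum_mul_sum, ← Finset.sum_product']
          refine Finset.sum_congr rfl fun x _ => ?_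
          rw [Nat.cast_mul, Real.mul_rpow (Nat.cast_nonneg _) (Nat.cast_nonneg _)]
      _ ≤ ∑ n ∈ Finset.Icc 1 (Y * N), (n : ℝ) ^ (δ - 1) := by
          refine Finset.sum_le_sum_of_subset_of_nonneg ?_ fun _ _ _ => by positivity
          intro n hn
          obtain ⟨⟨k, T⟩, hx, rfl⟩ := Finset.mem_image.1 hn
          obtain ⟨hk, hT⟩ := Finset.mem_product.1 hx
          obtain ⟨hT, hTN⟩ := hmem T hT
          exact Finset.mem_Icc.2 ⟨Nat.mul_pos (hK k hk).1 (Nat.prod_primesLE_pos hT),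
            Nat.mul_le_mul (hK k hk).2.1 hTN⟩
      _ ≤ _ := Finset.sum_Icc_rpow_sub_one_le h0 h1 _
  have hS : 0 ≤ ∑ k ∈ K, (k : ℝ) ^ (δ - 1) := Finset.sum_nonneg fun _ _ => by positivity
  calc _ ≤ (∑ k ∈ K, (k : ℝ) ^ (δ - 1)) * (2 * ∑ T ∈ 𝒯, ((∏ p ∈ T, p : ℕ) : ℝ)⁻¹) :=
        mul_le_mul_of_nonneg_left (Nat.log_succ_le_two_mul_sum_inv_prod_primes N) hS
    _ = 2 * ((∑ k ∈ K, (k : ℝ) ^ (δ - 1)) * ∑ T ∈ 𝒯, ((∏ p ∈ T, p : ℕ) : ℝ)⁻¹) := by ring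
    _ ≤ 2 * (((Y * N : ℕ) : ℝ) ^ δ / δ) := by gcongr
    _ = _ := by ring

open Finset in
theorem IsAntichain.sum_prod_le_sqrt_mul_prod {α : Type*} [DecidableEq α]
    {𝒜 : Finset (Finset α)} (h𝒜 : IsAntichain (· ⊆ ·) (𝒜 : Set (Finset α))) {P : Finset α}
    (hP : ∀ s ∈ 𝒜, s ⊆ P) (q : α → ℝ) (h0 : ∀ i ∈ P, 0 ≤ q i) (hq : ∀ i ∈ P, q i ≤ 2 / 3)
    {S : ℝ} (hS : 0 < S) (hSq : S ≤ ∑ i ∈ P, q i) :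
    ∑ s ∈ 𝒜, ∏ i ∈ s, q i ≤ √(5 / (2 * S)) * ∏ i ∈ P, (1 + q i) := by
  have h1q : ∀ i ∈ P, 0 < 1 - q i := fun i hi => by linarith [hq i hi]
  set r : α → ℝ := fun i => q i * (1 - q i)⁻¹ with hr
  have hrq : ∀ i ∈ P, q i ≤ r i := fun i hi => by
    rw [hr]
    exact le_mul_of_one_le_right (h0 i hi)
      ((one_le_inv₀ (h1q i hi)).2 (by linarith [h0 i hi]))
  have hr0 : ∀ i ∈ P, 0 ≤ r i := fun i hi => (h0 i hi).trans (hrq i hi)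
  have hrB : ∀ i ∈ P, 2 * r i ≤ 4 := fun i hi => by
    have : r i ≤ 2 := by
      simp only [hr, ← div_eq_mul_inv]
      rw [div_le_iff₀ (h1q i hi)]
      linarith [hq i hi]
    linarith
  have hV : 2 * S ≤ ∑ i ∈ P, 2 * r i := by
    rw [← mul_sum]
    exact mul_le_mul_of_nonneg_left (hSq.trans (sum_le_sum hrq)) zero_le_two
  set D := ∏ i ∈ P, (1 - q i)⁻¹ with hD
  have hD0 : 0 < D := prod_pos fun i hi => inv_pos.2 (h1q i hi)
  have hmain := h𝒜.sum_prod_mul_prod_sdiff_le hP r (B := 4) (by norm_num) hr0 hrB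
    (by linarith)
  have hL : ∑ s ∈ 𝒜, (∏ i ∈ s, r i) * ∏ i ∈ P \ s, (1 + r i) = (∑ s ∈ 𝒜, ∏ i ∈ s, q i) * D := by
    rw [sum_mul]
    refine sum_congr rfl fun s hs => ?_
    have : ∏ i ∈ P \ s, (1 + r i) = ∏ i ∈ P \ s, (1 - q i)⁻¹ :=
      prod_congr rfl fun i hi => by
        have := (h1q i (mem_sdiff.1 hi).1).ne'
        simp only [hr]; field_simp; ring
    rw [this, hr, prod_mul_distrib, hD, ← prod_sdiff (hP s hs)]
    ring
  have hR : ∏ i ∈ P, (1 + 2 * r i) = (∏ i ∈ P, (1 + q i)) * D := by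
    rw [hD, ← prod_mul_distrib]
    refine prod_congr rfl fun i hi => ?_
    have := (h1q i hi).ne'
    simp only [hr]; field_simp; ring
  rw [hL, hR, ← mul_assoc] at hmain
  refine (le_of_mul_le_mul_right hmain hD0).trans ?_
  have hprod : 0 ≤ ∏ i ∈ P, (1 + q i) := prod_nonneg fun i hi => by linarith [h0 i hi]
  gcongr
  norm_num

open Finset in
theorem Primitive.sum_rpow_le {A : Set ℕ} (hA : Primitive A) {W : Finset ℕ}
    (hWA : ∀ n ∈ W, n ∈ A) (N : ℕ) {σ : ℝ}
    {M : ℝ} (hM : ∀ 𝒜 : Finset (Finset ℕ), IsAntichain (· ⊆ ·) (𝒜 : Set (Finset ℕ)) →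
      (∀ s ∈ 𝒜, s ⊆ N.primesLE) → ∑ s ∈ 𝒜, ∏ p ∈ s, (p : ℝ) ^ σ ≤ M) :
    ∑ n ∈ W, (n : ℝ) ^ σ ≤ (∑ k ∈ W.image N.evenCofactor, (k : ℝ) ^ σ) * M := by
  rw [← sum_fiberwise_of_maps_to (g := N.evenCofactor) (fun n hn => mem_image_of_mem _ hn),
    sum_mul]
  refine sum_le_sum fun k _ => ?_
  set F := W.filter fun n => N.evenCofactor n = k with hF
  have hmem : ∀ n ∈ F, n ∈ W ∧ k * ∏ p ∈ N.oddPrimes n, p = n := fun n hn => by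
    obtain ⟨hnW, rfl⟩ := mem_filter.1 hn
    exact ⟨hnW, Nat.evenCofactor_mul_prod N n⟩
  have hinj : Set.InjOn N.oddPrimes (F : Set ℕ) := by
    intro m hm n hn h
    rw [← (hmem m hm).2, ← (hmem n hn).2, h]
  have hanti : IsAntichain (· ⊆ ·) ((F.image N.oddPrimes : Finset _) : Set (Finset ℕ)) := by
    intro s hs t ht hne hst
    obtain ⟨m, hm, rfl⟩ := mem_image.1 (mem_coe.1 hs)
    obtain ⟨n, hn, rfl⟩ := mem_image.1 (mem_coe.1 ht)
    refine hA m (hWA m (hmem m hm).1) n (hWA n (hmem n hn).1) (fun h => hne (by rw [h])) ?_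
    rw [← (hmem m hm).2, ← (hmem n hn).2]
    exact mul_dvd_mul_left k (prod_dvd_prod_of_subset _ _ _ hst)
  calc ∑ n ∈ F, (n : ℝ) ^ σ = (k : ℝ) ^ σ * ∑ s ∈ F.image N.oddPrimes, ∏ p ∈ s, (p : ℝ) ^ σ := by
        rw [sum_image hinj, mul_sum]
        refine sum_congr rfl fun n hn => ?_
        conv_lhs => rw [← (hmem n hn).2]
        rw [Nat.cast_mul, Real.mul_rpow k.cast_nonneg (Nat.cast_nonneg _), Nat.cast_prod,
          Real.finsetProd_rpow _ _ fun p _ => p.cast_nonneg]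
    _ ≤ _ := by
        refine mul_le_mul_of_nonneg_left (hM _ hanti fun s hs => ?_) (by positivity)
        obtain ⟨n, -, rfl⟩ := mem_image.1 hs
        exact Nat.oddPrimes_subset N n

theorem Real.rpow_sub_one_le_two_thirds {δ : ℝ} (hδ : δ ≤ 1 / 4) {p : ℝ} (hp : 2 ≤ p) :
    p ^ (δ - 1) ≤ 2 / 3 := by
  calc p ^ (δ - 1) ≤ p ^ (-(3 / 4) : ℝ) :=
        Real.rpow_le_rpow_of_exponent_le (by linarith) (by linarith)
    _ ≤ 2 ^ (-(3 / 4) : ℝ) :=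
        Real.rpow_le_rpow_of_nonpos (by norm_num) hp (by norm_num)
    _ ≤ 2 / 3 := by
        have h : ((2 : ℝ) ^ (-(3 / 4) : ℝ)) ^ 4 = 1 / 8 := by
          rw [← Real.rpow_natCast, ← Real.rpow_mul zero_le_two,
            show (-(3 / 4) : ℝ) * ((4 : ℕ) : ℝ) = -((3 : ℕ) : ℝ) by norm_num,
            Real.rpow_neg zero_le_two, Real.rpow_natCast]
          norm_num
        refine le_of_pow_le_pow_left₀ (n := 4) (by norm_num) (by norm_num) ?_
        rw [h]
        norm_num

theorem sum_inv_le_rpow_mul_sum {x y δ : ℝ} (hx : 0 < x) (hy : 0 < y) (hδ : 0 ≤ δ)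
    {W : Finset ℕ} (hW : ∀ n ∈ W, y / x ≤ (n : ℝ)) :
    ∑ n ∈ W, 1 / (n : ℝ) ≤ (x / y) ^ δ * ∑ n ∈ W, (n : ℝ) ^ (δ - 1) := by
  rw [Finset.mul_sum]
  refine Finset.sum_le_sum fun n hn => ?_
  have hyx : 0 < y / x := by positivity
  have hn0 : 0 < (n : ℝ) := hyx.trans_le (hW n hn)
  rw [Real.rpow_sub_one hn0.ne', ← mul_div_assoc, ← Real.mul_rpow (by positivity) hn0.le]
  gcongr
  refine Real.one_le_rpow ?_ hδ
  rw [← div_le_iff₀' (by positivity), one_div_div]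
  exact hW n hn

theorem Primitive.sum_inv_le_of_large {A : Set ℕ} (hA : Primitive A) {x y : ℝ}
    (hx : Real.exp 4 ≤ x) (hxy : x ≤ y) {W : Finset ℕ} (hWA : ∀ n ∈ W, n ∈ A)
    (hW : ∀ n ∈ W, y / x ≤ (n : ℝ) ∧ (n : ℝ) ≤ y) :
    ∑ n ∈ W, 1 / (n : ℝ) ≤
      12 * Real.exp 8 * Real.log x / √(Real.log (Real.log x)) := by
  have hx1 : 1 < x := (Real.one_lt_exp_iff.2 (by norm_num)).trans_le hx
  have hx0 : 0 < x := by linarith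
  have hy0 : 0 < y := by linarith
  set N := ⌊x⌋₊ with hN
  have hN1 : 1 ≤ N := Nat.le_floor (by exact_mod_cast hx1.le)
  have hNx : (N : ℝ) ≤ x := Nat.floor_le hx0.le
  have hxN : x ≤ N + 1 := (Nat.lt_floor_add_one x).le
  set L := Real.log x with hL
  have hL4 : 4 ≤ L := (Real.le_log_iff_exp_le hx0).2 hx
  have hL0 : 0 < L := by linarith
  have hLN : L ≤ Real.log (N + 1) := Real.log_le_log hx0 hxN
  set δ := L⁻¹ with hδ
  have hδ0 : 0 < δ := inv_pos.2 hL0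
  have hδ4 : δ ≤ 1 / 4 := by
    rw [hδ, inv_le_comm₀ hL0 (by norm_num)]; linarith
  have hδL : δ * L = 1 := inv_mul_cancel₀ hL0.ne'
  have hxδ : x ^ δ = Real.exp 1 := by
    rw [Real.rpow_def_of_pos hx0, ← hL, mul_comm, hδL]
  set ℓ := Real.log L with hℓ
  have hl4 : 2 * Real.log 2 ≤ ℓ := by
    have : Real.log 4 = 2 * Real.log 2 := by
      rw [show (4 : ℝ) = 2 ^ 2 by norm_num, Real.log_pow]; norm_num
    rw [← this]
    exact Real.log_le_log (by norm_num) hL4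
  have hl0 : 0 < ℓ := Real.log_pos (by linarith)
  have hpow : ∀ p ∈ N.primesLE, (2 : ℝ) ≤ p := fun p hp => by
    exact_mod_cast (Nat.mem_primesLE.1 hp).2.two_le
  have hsum : ℓ / 2 ≤ ∑ p ∈ N.primesLE, (p : ℝ) ^ (δ - 1) := by
    have h1 := Nat.log_log_sub_le_sum_inv_primesLE hN1
    have h2 : ℓ / 2 ≤ Real.log (Real.log (N + 1) / 2) := by
      calc ℓ / 2 ≤ Real.log (L / 2) := by
            rw [Real.log_div hL0.ne' (by norm_num)]; linarith
        _ ≤ _ := Real.log_le_log (by positivity) (by gcongr)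
    refine (h2.trans h1).trans (Finset.sum_le_sum fun p hp => ?_)
    rw [← Real.rpow_neg_one]
    exact Real.rpow_le_rpow_of_exponent_le (by linarith [hpow p hp]) (by linarith)
  have hprod : ∏ p ∈ N.primesLE, (1 + (p : ℝ) ^ (δ - 1)) ≤ 2 * Real.exp 6 * L := by
    refine (Nat.prod_one_add_rpow_sub_one_primesLE_le hδ0 (by linarith) ?_).trans ?_
    · rw [← hδL]
      have : Real.log N ≤ L := Real.log_le_log (by exact_mod_cast hN1) hNx
      gcongr
    · rw [hδ, one_div, inv_inv]
      nlinarith [Real.exp_pos 6]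
  set M := √(5 / ℓ) * (2 * Real.exp 6 * L) with hM
  have hM0 : 0 ≤ M := by positivity
  have h𝒜 : ∀ 𝒜 : Finset (Finset ℕ), IsAntichain (· ⊆ ·) (𝒜 : Set (Finset ℕ)) →
      (∀ s ∈ 𝒜, s ⊆ N.primesLE) → ∑ s ∈ 𝒜, ∏ p ∈ s, (p : ℝ) ^ (δ - 1) ≤ M := by
    intro 𝒜 hanti hsub
    refine (hanti.sum_prod_le_sqrt_mul_prod hsub (fun p : ℕ => (p : ℝ) ^ (δ - 1))
      (fun _ _ => by positivity)
      (fun p hp => Real.rpow_sub_one_le_two_thirds hδ4 (hpow p hp)) (half_pos hl0) hsum).trans ?_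
    rw [mul_div_cancel₀ ℓ two_ne_zero]
    exact mul_le_mul_of_nonneg_left hprod (Real.sqrt_nonneg _)
  have hW0 : ∀ n ∈ W, 0 < n := fun n hn => by
    have h1 : 0 < y / x := by positivity
    exact_mod_cast h1.trans_le (hW n hn).1
  have hK : (∑ k ∈ W.image N.evenCofactor, (k : ℝ) ^ (δ - 1)) ≤ 2 * (y * x) ^ δ := by
    have h1 := Nat.sum_rpow_sub_one_mul_log_le hδ0 (by linarith) (N := N) (Y := ⌊y⌋₊)
      (W.image N.evenCofactor) (fun k hk => by
        obtain ⟨n, hn, rfl⟩ := Finset.mem_image.1 hk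
        refine ⟨Nat.evenCofactor_pos (hW0 n hn), ?_,
          fun p hp => Nat.even_factorization_evenCofactor (hW0 n hn) hp⟩
        exact (Nat.div_le_self _ _).trans (Nat.le_floor (hW n hn).2))
    have hS : 0 ≤ ∑ k ∈ W.image N.evenCofactor, (k : ℝ) ^ (δ - 1) :=
      Finset.sum_nonneg fun _ _ => by positivity
    refine le_of_mul_le_mul_right ?_ hL0
    calc _ ≤ (∑ k ∈ W.image N.evenCofactor, (k : ℝ) ^ (δ - 1)) * Real.log (N + 1) := by gcongr
      _ ≤ _ := h1
      _ ≤ 2 * (y * x) ^ δ / δ := by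
          rw [Nat.cast_mul]
          have := Nat.floor_le hy0.le
          gcongr
      _ = _ := by rw [hδ, div_inv_eq_mul]
  have hxx : (x / y) ^ δ * (y * x) ^ δ = Real.exp 1 * Real.exp 1 := by
    rw [← Real.mul_rpow (by positivity) (by positivity), ← hxδ,
      ← Real.mul_rpow hx0.le hx0.le]
    congr 1
    field_simp
  calc ∑ n ∈ W, 1 / (n : ℝ)
      ≤ (x / y) ^ δ * ∑ n ∈ W, (n : ℝ) ^ (δ - 1) :=
        sum_inv_le_rpow_mul_sum hx0 hy0 hδ0.le fun n hn => (hW n hn).1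
    _ ≤ (x / y) ^ δ * ((2 * (y * x) ^ δ) * M) := by
        gcongr
        exact (hA.sum_rpow_le hWA N h𝒜).trans (by gcongr)
    _ = 2 * ((x / y) ^ δ * (y * x) ^ δ) * M := by ring
    _ = 4 * Real.exp 8 * L * √5 / √ℓ := by
        rw [hxx, hM, Real.sqrt_div (by norm_num),
          show Real.exp 8 = Real.exp 1 * Real.exp 1 * Real.exp 6 by
            rw [← Real.exp_add, ← Real.exp_add]; norm_num]
        ring
    _ ≤ 4 * Real.exp 8 * L * 3 / √ℓ := by
        gcongr
        rw [Real.sqrt_le_left (by norm_num)]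
        norm_num
    _ = _ := by ring

theorem sum_inv_le_of_small {x y : ℝ} (hx3 : 3 ≤ x)
    (hx : x < Real.exp 4) (hxy : x ≤ y) {W : Finset ℕ}
    (hW : ∀ n ∈ W, y / x ≤ (n : ℝ) ∧ (n : ℝ) ≤ y) :
    ∑ n ∈ W, 1 / (n : ℝ) ≤
      12 * Real.exp 8 * Real.log x / √(Real.log (Real.log x)) := by
  have hx0 : 0 < x := by linarith
  have hy0 : 0 < y := by linarith
  set L := Real.log x with hL
  have hL1 : 1 < L := (Real.lt_log_iff_exp_lt hx0).2 (Real.exp_one_lt_three.trans_le hx3)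
  have hL0 : 0 < L := by linarith
  have hL4 : L ≤ 4 := ((Real.log_lt_iff_lt_exp hx0).2 hx).le
  set δ := L⁻¹ with hδ
  have hδ0 : 0 < δ := inv_pos.2 hL0
  have hδ1 : δ ≤ 1 := inv_le_one_of_one_le₀ hL1.le
  have hxδ : x ^ δ = Real.exp 1 := by
    rw [Real.rpow_def_of_pos hx0, ← hL, hδ, mul_inv_cancel₀ hL0.ne']
  have hsum : ∑ n ∈ W, (n : ℝ) ^ (δ - 1) ≤ y ^ δ * L := by
    calc ∑ n ∈ W, (n : ℝ) ^ (δ - 1) ≤ ∑ n ∈ Finset.Icc 1 ⌊y⌋₊, (n : ℝ) ^ (δ - 1) := by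
          refine Finset.sum_le_sum_of_subset_of_nonneg (fun n hn => ?_)
            fun _ _ _ => by positivity
          have h1 : 0 < y / x := by positivity
          have h2 : 0 < n := by exact_mod_cast h1.trans_le (hW n hn).1
          exact Finset.mem_Icc.2 ⟨h2, Nat.le_floor (hW n hn).2⟩
      _ ≤ (⌊y⌋₊ : ℝ) ^ δ / δ := Finset.sum_Icc_rpow_sub_one_le hδ0 hδ1 _
      _ ≤ y ^ δ / δ := by
          have := Nat.floor_le hy0.le
          gcongr
      _ = y ^ δ * L := by rw [hδ, div_inv_eq_mul]
  have hl0 : 0 < Real.log L := Real.log_pos hL1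
  have hsqrt : √(Real.log L) ≤ 2 := by
    rw [Real.sqrt_le_left (by norm_num)]
    linarith [Real.log_le_sub_one_of_pos hL0]
  calc ∑ n ∈ W, 1 / (n : ℝ) ≤ (x / y) ^ δ * ∑ n ∈ W, (n : ℝ) ^ (δ - 1) :=
        sum_inv_le_rpow_mul_sum hx0 hy0 hδ0.le fun n hn => (hW n hn).1
    _ ≤ (x / y) ^ δ * (y ^ δ * L) := by gcongr
    _ = Real.exp 1 * L := by
        rw [← mul_assoc, ← Real.mul_rpow (by positivity) hy0.le, div_mul_cancel₀ _ hy0.ne', hxδ]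
    _ ≤ Real.exp 8 * L := by gcongr; norm_num
    _ ≤ 12 * Real.exp 8 * L / 2 := by nlinarith [mul_pos (Real.exp_pos 8) hL0]
    _ ≤ _ := by gcongr

theorem aks_inequality :
    ∃ C : ℝ, ∀ x y : ℝ, 3 ≤ x → x ≤ y → ∀ A : Set ℕ, Primitive A →
      ∑' n : {n : ℕ // n ∈ A ∧ y / x ≤ (n : ℝ) ∧ (n : ℝ) ≤ y}, 1 / ((n : ℕ) : ℝ) ≤
        C * Real.log x / Real.sqrt (Real.log (Real.log x)) := by
  classical
  refine ⟨12 * Real.exp 8, fun x y hx hxy A hA => ?_⟩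
  have hy0 : 0 ≤ y := by linarith
  set W : Finset ℕ :=
    {n ∈ Finset.Icc 0 ⌊y⌋₊ | n ∈ A ∧ y / x ≤ (n : ℝ) ∧ (n : ℝ) ≤ y} with hW
  have hmem : ∀ n, n ∈ W ↔ n ∈ A ∧ y / x ≤ (n : ℝ) ∧ (n : ℝ) ≤ y := by
    intro n
    rw [hW, Finset.mem_filter, and_iff_right_iff_imp, Finset.mem_Icc]
    exact fun h => ⟨n.zero_le, Nat.le_floor h.2.2⟩
  have hset : {n : ℕ | n ∈ A ∧ y / x ≤ (n : ℝ) ∧ (n : ℝ) ≤ y} = (W : Set ℕ) := by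
    ext n; exact (hmem n).symm
  have htsum : ∑' n : {n : ℕ // n ∈ A ∧ y / x ≤ (n : ℝ) ∧ (n : ℝ) ≤ y}, 1 / ((n : ℕ) : ℝ) =
      ∑ n ∈ W, 1 / (n : ℝ) :=
    (tsum_congr_set_coe (fun n : ℕ => 1 / (n : ℝ)) hset).trans
      (Finset.tsum_subtype W fun n : ℕ => 1 / (n : ℝ))
  rw [htsum]
  have hWb : ∀ n ∈ W, y / x ≤ (n : ℝ) ∧ (n : ℝ) ≤ y := fun n hn => ((hmem n).1 hn).2
  rcases lt_or_ge x (Real.exp 4) with h | h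
  · exact sum_inv_le_of_small hx h hxy hWb
  · exact hA.sum_inv_le_of_large h hxy (fun n hn => ((hmem n).1 hn).1) hWb
end

section
/- Let $A$ be a set of natural numbers (not containing $1$) such that the upper doubly logarithmic density $\Delta := \limsup_{x\to\infty} \frac{1}{\log\log x} \sum_{a \in A,\ a \leq x} \frac{1}{a \log a}$ is positive. Then there exists a strictly increasing infinite divisibility chain $n_0 \mid n_1 \mid n_2 \mid \cdots$ with all $n_i \in A$ and $n_i < n_{i+1}$ for all $i$, such that $\limsup_{x\to\infty} \frac{1}{\log\log x} \#\{i : n_i \leq x\} \geq \Delta$. -/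
open Filter

open MeasureTheory ProbabilityTheory Real

theorem tsum_rpow_neg_le {t : ℝ} (ht : 1 < t) : ∑' n : ℕ, ((n : ℝ) ^ (-t)) ≤ t / (t - 1) := by
  have hs : Summable fun n : ℕ => (n : ℝ) ^ (-t) := Real.summable_nat_rpow.2 (by linarith)
  have h := ZetaAsymptotics.zeta_limit_aux1 ht
  have h0 : 0 ≤ ZetaAsymptotics.termTSum t :=
    tsum_nonneg fun n => ZetaAsymptotics.term_nonneg _ _
  have h1 : ∑' n : ℕ, ((n : ℝ) ^ (-t)) = ∑' n : ℕ, 1 / (n + 1 : ℝ) ^ t := by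
    rw [hs.tsum_eq_zero_add]
    have h2 : ((0 : ℕ) : ℝ) ^ (-t) = 0 := by
      rw [Nat.cast_zero, Real.zero_rpow (by linarith)]
    rw [h2, zero_add]
    refine tsum_congr fun n => ?_
    rw [Real.rpow_neg (by positivity)]
    push_cast
    rw [one_div]
  have h3 : t / (t - 1) = 1 + 1 / (t - 1) := by
    have : t - 1 ≠ 0 := (sub_pos.2 ht).ne'
    field_simp
    ring
  rw [h1, h3]
  nlinarith [mul_nonneg (by linarith : 0 ≤ t) h0]

theorem le_prod_one_sub_rpow_neg {t : ℝ} (ht : 1 < t) (S : Finset ℕ) (hS : ∀ q ∈ S, q.Prime) :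
    (t - 1) / t ≤ ∏ q ∈ S, (1 - (q : ℝ) ^ (-t)) := by
  let f : ℕ →* ℝ :=
    { toFun := fun n => (n : ℝ) ^ (-t)
      map_one' := by simp
      map_mul' := fun m n => by
        push_cast
        exact Real.mul_rpow (by positivity) (by positivity) }
  have hs : Summable f := Real.summable_nat_rpow.2 (by linarith : -t < -1)
  have h := EulerProduct.prod_filter_prime_geometric_eq_tsum_factoredNumbers hs S
  rw [Finset.filter_true_of_mem hS] at h
  have h1 : ∑' m : Nat.factoredNumbers S, f m ≤ t / (t - 1) :=
    (Summable.tsum_subtype_le f _ (fun n => Real.rpow_nonneg n.cast_nonneg _) hs).trans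
      (tsum_rpow_neg_le ht)
  rw [← h, Finset.prod_inv_distrib] at h1
  have hpos : 0 < ∏ q ∈ S, (1 - f q) := Finset.prod_pos fun q hq =>
    sub_pos.2 <| Real.rpow_lt_one_of_one_lt_of_neg
      (by exact_mod_cast (hS q hq).one_lt) (by linarith)
  have h2 := inv_anti₀ (inv_pos.2 hpos) h1
  rwa [inv_inv, inv_div] at h2

theorem sum_primes_inv_le {X : ℝ} (hX : 1 < X) (S : Finset ℕ) (hS : ∀ q ∈ S, q.Prime)
    (hSX : ∀ q ∈ S, (q : ℝ) ≤ X) :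
    ∑ q ∈ S, (1 / q : ℝ) ≤ exp 1 * log (1 + log X) := by
  have hL : 0 < log X := log_pos hX
  set t : ℝ := 1 + 1 / log X with ht
  have ht1 : 1 < t := by rw [ht]; linarith [one_div_pos.2 hL]
  have h1 := le_prod_one_sub_rpow_neg ht1 S hS
  have h2 : ∏ q ∈ S, (1 - (q : ℝ) ^ (-t)) ≤ exp (-∑ q ∈ S, (q : ℝ) ^ (-t)) := by
    rw [← Finset.sum_neg_distrib, exp_sum]
    refine Finset.prod_le_prod (fun q hq => sub_nonneg.2 ?_) fun q hq => ?_
    · exact (Real.rpow_lt_one_of_one_lt_of_neg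
        (by exact_mod_cast (hS q hq).one_lt) (by linarith)).le
    · linarith [add_one_le_exp (-(q : ℝ) ^ (-t))]
  have h3 : (t - 1) / t = (1 + log X)⁻¹ := by
    rw [ht]; field_simp; ring
  have h4 : ∑ q ∈ S, (q : ℝ) ^ (-t) ≤ log (1 + log X) := by
    have := h1.trans h2
    rw [h3, ← log_le_iff_le_exp (by positivity), log_inv] at this
    linarith
  have h5 : ∀ q ∈ S, (1 / q : ℝ) ≤ exp 1 * (q : ℝ) ^ (-t) := fun q hq => by
    have hq0 : (0 : ℝ) < q := by exact_mod_cast (hS q hq).pos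
    rw [Real.rpow_def_of_pos hq0, ← exp_add, one_div, ← exp_log hq0, ← exp_neg, exp_le_exp,
      exp_log hq0, ht]
    have : log q / log X ≤ 1 := (div_le_one hL).2 (log_le_log hq0 (hSX q hq))
    have h6 : log q * -(1 + 1 / log X) = - log q - log q / log X := by ring
    linarith
  calc _ ≤ ∑ q ∈ S, exp 1 * (q : ℝ) ^ (-t) := Finset.sum_le_sum h5
    _ = exp 1 * ∑ q ∈ S, (q : ℝ) ^ (-t) := by rw [Finset.mul_sum]
    _ ≤ _ := by gcongr

theorem expMeasure_Ioc {r a b : ℝ} (hr : 0 < r) (ha : 0 ≤ a) (hab : a ≤ b) :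
    expMeasure r (Set.Ioc a b) = ENNReal.ofReal (exp (-(r * a)) - exp (-(r * b))) := by
  have := isProbabilityMeasure_expMeasure hr
  rw [← measure_cdf (expMeasure r), StieltjesFunction.measure_Ioc, cdf_expMeasure_eq hr,
    cdf_expMeasure_eq hr, if_pos ha, if_pos (ha.trans hab)]
  congr 1; ring

theorem nullSingletonClass_expMeasure (r : ℝ) : NullSingletonClass (expMeasure r) :=
  ⟨fun x => withDensity_absolutelyContinuous _ _ (measure_singleton x)⟩

theorem expMeasure_Ioo {r a b : ℝ} (hr : 0 < r) (ha : 0 ≤ a) (hab : a ≤ b) :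
    expMeasure r (Set.Ioo a b) = ENNReal.ofReal (exp (-(r * a)) - exp (-(r * b))) := by
  have := nullSingletonClass_expMeasure r
  rw [← expMeasure_Ioc hr ha hab, measure_congr Ioo_ae_eq_Ioc]

theorem expMeasure_Ici {r a : ℝ} (hr : 0 < r) (ha : 0 ≤ a) :
    expMeasure r (Set.Ici a) = ENNReal.ofReal (exp (-(r * a))) := by
  have := nullSingletonClass_expMeasure r
  have := isProbabilityMeasure_expMeasure hr
  rw [← measure_congr Ioi_ae_eq_Ici, ← Set.compl_Iic, prob_compl_eq_one_sub measurableSet_Iic,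
    ← ofReal_cdf, cdf_expMeasure_eq hr, if_pos ha, ← ENNReal.ofReal_one,
    ← ENNReal.ofReal_sub _ (by simp; positivity)]
  congr 1; ring

theorem measurePreserving_update_infinitePi {ι : Type*} [DecidableEq ι] {X : ι → Type*}
    [∀ i, MeasurableSpace (X i)] (μ : ∀ i, Measure (X i)) [∀ i, IsProbabilityMeasure (μ i)]
    (p : ι) :
    MeasurePreserving (fun z : X p × (∀ i, X i) => Function.update z.2 p z.1)
      ((μ p).prod (Measure.infinitePi μ)) (Measure.infinitePi μ) := by
  have hm : Measurable fun z : X p × (∀ i, X i) => Function.update z.2 p z.1 := by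
    refine measurable_pi_lambda _ fun i => ?_
    by_cases h : i = p
    · subst h; simpa using measurable_fst
    · simp only [Function.update_of_ne h]; fun_prop
  refine ⟨hm, Measure.eq_infinitePi _ fun s t ht => ?_⟩
  rw [Measure.map_apply hm (.pi s.countable_toSet fun i _ => ht i)]
  by_cases hp : p ∈ s
  · have : (fun z : X p × (∀ i, X i) => Function.update z.2 p z.1) ⁻¹' (s : Set ι).pi t
        = t p ×ˢ ((s.erase p : Finset ι) : Set ι).pi t := by
      ext z
      simp only [Set.mem_preimage, Set.mem_pi, Finset.mem_coe, Set.mem_prod, Finset.mem_erase]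
      constructor
      · intro h
        refine ⟨by simpa using h p hp, fun i hi => ?_⟩
        simpa [Function.update_of_ne hi.1] using h i hi.2
      · rintro ⟨h1, h2⟩ i hi
        by_cases h : i = p
        · subst h; simpa using h1
        · simpa [Function.update_of_ne h] using h2 i ⟨h, hi⟩
    rw [this, Measure.prod_prod, Measure.infinitePi_pi _ fun i _ => ht i,
      Finset.mul_prod_erase s (fun i => μ i (t i)) hp]
  · have : (fun z : X p × (∀ i, X i) => Function.update z.2 p z.1) ⁻¹' (s : Set ι).pi t
        = Set.univ ×ˢ (s : Set ι).pi t := by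
      ext z
      simp only [Set.mem_preimage, Set.mem_pi, Finset.mem_coe, Set.mem_prod, Set.mem_univ,
        true_and]
      refine forall₂_congr fun i hi => ?_
      rw [Function.update_of_ne (by rintro rfl; exact hp hi)]
    rw [this, Measure.prod_prod, Measure.infinitePi_pi _ fun i _ => ht i, measure_univ, one_mul]

/-- The integer `n` is reached by the process attached to the clocks `T` at the moment when the
exponent of the prime `p` jumps to its final value `n.factorization p`. -/
def ReachedVia (T : ℕ → ℝ) (n p : ℕ) : Prop :=
  (n.factorization p : ℝ) < T p ∧ ∀ q, q.Prime → q ≠ p →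
    T q ∈ Set.Ioo (n.factorization q * (T p / n.factorization p))
      ((n.factorization q + 1) * (T p / n.factorization p))

/-- The set of integers reached by the process attached to the clocks `T`; it is a chain for
divisibility. -/
def reached (T : ℕ → ℝ) : Set ℕ := {n | ∃ p ∈ n.primeFactors, ReachedVia T n p}

theorem factorization_pos_of_mem_primeFactors {n p : ℕ} (hp : p ∈ n.primeFactors) :
    0 < n.factorization p :=
  Nat.pos_of_ne_zero (Finsupp.mem_support_iff.1 (by rwa [Nat.support_factorization]))

theorem ReachedVia.bounds {T : ℕ → ℝ} {n p q : ℕ} (hp : p ∈ n.primeFactors)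
    (h : ReachedVia T n p) (hq : q.Prime) :
    n.factorization q * (T p / n.factorization p) ≤ T q ∧
      T q < (n.factorization q + 1) * (T p / n.factorization p) := by
  have ha : (0 : ℝ) < n.factorization p := by
    exact_mod_cast factorization_pos_of_mem_primeFactors hp
  by_cases hqp : q = p
  · subst hqp
    have h0 : 0 < T q / n.factorization q := div_pos (ha.trans h.1) ha
    have h1 : (n.factorization q : ℝ) * (T q / n.factorization q) = T q := by field_simp
    constructor <;> nlinarith
  · exact ⟨(h.2 q hq hqp).1.le, (h.2 q hq hqp).2⟩

theorem ReachedVia.one_lt {T : ℕ → ℝ} {n p : ℕ} (hp : p ∈ n.primeFactors)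
    (h : ReachedVia T n p) : 1 < T p / n.factorization p := by
  have ha : (0 : ℝ) < n.factorization p := by
    exact_mod_cast factorization_pos_of_mem_primeFactors hp
  exact (one_lt_div ha).2 h.1

theorem ne_zero_of_mem_reached {T : ℕ → ℝ} {n : ℕ} (h : n ∈ reached T) : n ≠ 0 := by
  rintro rfl
  obtain ⟨p, hp, -⟩ := h
  simp at hp

theorem two_le_of_mem_reached {T : ℕ → ℝ} {n : ℕ} (h : n ∈ reached T) : 2 ≤ n := by
  obtain ⟨p, hp, -⟩ := id h
  exact (Nat.prime_of_mem_primeFactors hp).two_le.trans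
    (Nat.le_of_dvd (Nat.pos_of_ne_zero (ne_zero_of_mem_reached h)) (Nat.dvd_of_mem_primeFactors hp))

theorem dvd_or_dvd_of_mem_reached {T : ℕ → ℝ} {n m : ℕ} (hn : n ∈ reached T)
    (hm : m ∈ reached T) : n ∣ m ∨ m ∣ n := by
  have key : ∀ {n m p q : ℕ}, n ≠ 0 → m ≠ 0 → p ∈ n.primeFactors → q ∈ m.primeFactors →
      ReachedVia T n p → ReachedVia T m q →
      T q / m.factorization q ≤ T p / n.factorization p → n ∣ m := by
    intro n m p q hn0 hm0 hp hq hnp hmq hle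
    rw [← Nat.factorization_prime_le_iff_dvd hn0 hm0]
    intro r hr
    have h1 := (hnp.bounds hp hr).1
    have h2 := (hmq.bounds hq hr).2
    have h3 := hnp.one_lt hp
    have h4 : ((m.factorization r : ℝ) + 1) * (T q / m.factorization q)
        ≤ (m.factorization r + 1) * (T p / n.factorization p) := by gcongr
    have h5 : (n.factorization r : ℝ) < m.factorization r + 1 :=
      lt_of_mul_lt_mul_right ((h1.trans_lt h2).trans_le h4) (by linarith)
    exact Nat.lt_succ_iff.1 (by exact_mod_cast h5)
  have hn0 := ne_zero_of_mem_reached hn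
  have hm0 := ne_zero_of_mem_reached hm
  obtain ⟨p, hp, hnp⟩ := hn
  obtain ⟨q, hq, hmq⟩ := hm
  rcases le_total (T q / m.factorization q) (T p / n.factorization p) with h | h
  · exact .inl (key hn0 hm0 hp hq hnp hmq h)
  · exact .inr (key hm0 hn0 hq hp hmq hnp h)

theorem card_le_cardFactors_of_chain {S : Finset ℕ} {m : ℕ} (hm0 : m ≠ 0)
    (h2 : ∀ n ∈ S, 2 ≤ n) (hdvd : ∀ n ∈ S, n ∣ m)
    (hchain : ∀ n ∈ S, ∀ k ∈ S, n ∣ k ∨ k ∣ n) :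
    S.card ≤ ArithmeticFunction.cardFactors m := by
  have hmono : ∀ {a b : ℕ}, b ≠ 0 → a ∣ b → a ≠ b →
      ArithmeticFunction.cardFactors a < ArithmeticFunction.cardFactors b := by
    rintro a b hb ⟨c, rfl⟩ hne
    have ha : a ≠ 0 := left_ne_zero_of_mul hb
    have hc : c ≠ 0 := right_ne_zero_of_mul hb
    rw [ArithmeticFunction.cardFactors_mul ha hc]
    have : ArithmeticFunction.cardFactors c ≠ 0 := by
      rw [Ne, ArithmeticFunction.cardFactors_eq_zero_iff_eq_zero_or_one]
      rintro (h | h)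
      · exact hc h
      · exact hne (by simp [h])
    omega
  have h := Finset.card_le_card_of_injOn (s := S)
    (t := Finset.Icc 1 (ArithmeticFunction.cardFactors m)) ArithmeticFunction.cardFactors
    (fun n hn => ?_) (fun a ha b hb hab => ?_)
  · simpa using h
  · have hn0 : n ≠ 0 := by have := h2 n hn; omega
    refine Finset.mem_coe.2 (Finset.mem_Icc.2 ⟨?_, ?_⟩)
    · exact (Nat.zero_le _).trans_lt (hmono hn0 (one_dvd n) (by have := h2 n hn; omega))
    · by_cases hnm : n = m
      · rw [hnm]
      · exact (hmono hm0 (hdvd n hn) hnm).le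
  · by_contra hne
    have ha0 : a ≠ 0 := by have := h2 a ha; omega
    have hb0 : b ≠ 0 := by have := h2 b hb; omega
    rcases hchain a ha b hb with h | h
    · exact (hmono hb0 h hne).ne hab
    · exact (hmono ha0 h (Ne.symm hne)).ne hab.symm

theorem card_le_sum_floor {T : ℕ → ℝ} {S : Finset ℕ} {N : ℕ} (hS : ∀ n ∈ S, n ∈ reached T)
    (hN : ∀ n ∈ S, n ≤ N) :
    S.card ≤ ∑ p ∈ (Finset.range (N + 1)).filter Nat.Prime, ⌊T p⌋₊ := by
  rcases S.eq_empty_or_nonempty with rfl | hne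
  · simp
  set m := S.max' hne
  have hmS : m ∈ S := S.max'_mem hne
  have hm0 := ne_zero_of_mem_reached (hS m hmS)
  have h1 := card_le_cardFactors_of_chain hm0 (fun n hn => two_le_of_mem_reached (hS n hn))
    (fun n hn => (dvd_or_dvd_of_mem_reached (hS n hn) (hS m hmS)).elim id fun h => by
      have := Nat.le_of_dvd (Nat.pos_of_ne_zero (ne_zero_of_mem_reached (hS n hn))) h
      have h3 : n = m := le_antisymm (S.le_max' n hn) this
      rw [h3])
    fun n hn k hk => dvd_or_dvd_of_mem_reached (hS n hn) (hS k hk)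
  refine h1.trans ?_
  rw [ArithmeticFunction.cardFactors_eq_sum_factorization, Finsupp.sum, Nat.support_factorization]
  obtain ⟨p, hp, hmp⟩ := hS m hmS
  calc ∑ q ∈ m.primeFactors, m.factorization q ≤ ∑ q ∈ m.primeFactors, ⌊T q⌋₊ := by
        refine Finset.sum_le_sum fun q hq => Nat.le_floor ?_
        have h2 := (hmp.bounds hp (Nat.prime_of_mem_primeFactors hq)).1
        have h3 := hmp.one_lt hp
        have h4 : (0 : ℝ) ≤ m.factorization q := by positivity
        nlinarith
    _ ≤ _ := by
        refine Finset.sum_le_sum_of_subset fun q hq => ?_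
        rw [Finset.mem_filter, Finset.mem_range]
        exact ⟨Nat.lt_succ_of_le ((Nat.le_of_mem_primeFactors hq).trans (hN m hmS)),
          Nat.prime_of_mem_primeFactors hq⟩

theorem sum_odd_eq_sq (k : ℕ) : ∑ j ∈ Finset.range k, (2 * (j : ℝ) + 1) = (k : ℝ) ^ 2 := by
  induction k with
  | zero => simp
  | succ k ih => rw [Finset.sum_range_succ, ih]; push_cast; ring

theorem ofReal_floor_sq (x : ℝ) :
    ENNReal.ofReal ((⌊x⌋₊ : ℝ) ^ 2) =
      ∑' j : ℕ, (Set.Ici ((j : ℝ) + 1)).indicator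
        (fun _ => ENNReal.ofReal (2 * (j : ℝ) + 1)) x := by
  rw [tsum_eq_sum (s := Finset.range ⌊x⌋₊), ← sum_odd_eq_sq,
    ENNReal.ofReal_sum_of_nonneg fun j _ => by positivity]
  · refine Finset.sum_congr rfl fun j hj => ?_
    rw [Set.indicator_of_mem]
    have h := Finset.mem_range.1 hj
    have := (Nat.le_floor_iff' (Nat.succ_ne_zero j)).1 (Nat.succ_le_of_lt h)
    simpa using this
  · intro j hj
    rw [Set.indicator_of_notMem]
    intro h
    refine hj (Finset.mem_range.2 ?_)
    exact Nat.lt_of_succ_le ((Nat.le_floor_iff' (Nat.succ_ne_zero j)).2 (by simpa using h))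

theorem exists_lintegral_floor_sq_le :
    ∃ C : ℝ, 0 ≤ C ∧ ∀ r, log 2 ≤ r →
      ∫⁻ x, ENNReal.ofReal ((⌊x⌋₊ : ℝ) ^ 2) ∂expMeasure r ≤ ENNReal.ofReal (C * exp (-r)) := by
  have hs : Summable fun j : ℕ => (2 * (j : ℝ) + 1) * (1 / 2) ^ j := by
    have h1 := summable_pow_mul_geometric_of_norm_lt_one 1 (r := (1 / 2 : ℝ)) (by norm_num)
    have h2 := summable_geometric_of_lt_one (r := (1 / 2 : ℝ)) (by norm_num) (by norm_num)
    refine ((h1.mul_left 2).add h2).congr fun j => ?_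
    ring
  refine ⟨∑' j : ℕ, (2 * (j : ℝ) + 1) * (1 / 2) ^ j, tsum_nonneg fun j => by positivity,
    fun r hr => ?_⟩
  have hr0 : 0 < r := (log_pos one_lt_two).trans_le hr
  simp_rw [ofReal_floor_sq]
  rw [lintegral_tsum fun j => (measurable_const.indicator measurableSet_Ici).aemeasurable,
    ← tsum_mul_right, ENNReal.ofReal_tsum_of_nonneg (fun j => by positivity) (hs.mul_right _)]
  refine ENNReal.tsum_le_tsum fun j => ?_
  rw [lintegral_indicator_const measurableSet_Ici, expMeasure_Ici hr0 (by positivity),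
    ← ENNReal.ofReal_mul (by positivity)]
  refine ENNReal.ofReal_le_ofReal ?_
  rw [mul_assoc]
  refine mul_le_mul_of_nonneg_left ?_ (by positivity)
  have h1 : exp (-(r * (j + 1))) = exp (-r) ^ j * exp (-r) := by
    rw [← exp_nat_mul, ← exp_add]; congr 1; ring
  have h2 : exp (-r) ≤ 1 / 2 := by
    rw [one_div, ← exp_log (two_pos : (0 : ℝ) < 2), ← exp_neg]
    exact exp_le_exp.2 (neg_le_neg hr)
  rw [h1]
  gcongr

/-- The rate of the clock attached to `q`, which is `log q` when `q` is prime. -/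
noncomputable def clockRate (q : ℕ) : ℝ := log (max q 2)

theorem log_two_le_clockRate (q : ℕ) : log 2 ≤ clockRate q :=
  log_le_log two_pos (le_max_right _ _)

theorem clockRate_pos (q : ℕ) : 0 < clockRate q :=
  (log_pos one_lt_two).trans_le (log_two_le_clockRate q)

theorem clockRate_of_prime {q : ℕ} (hq : q.Prime) : clockRate q = log q := by
  rw [clockRate, max_eq_left (by exact_mod_cast hq.two_le)]

instance isProbabilityMeasure_expMeasure_clockRate (q : ℕ) :
    IsProbabilityMeasure (expMeasure (clockRate q)) :=
  isProbabilityMeasure_expMeasure (clockRate_pos q)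

/-- Independent exponential clocks, the one attached to a prime `q` having rate `log q`. -/
noncomputable def clocks : Measure (ℕ → ℝ) :=
  Measure.infinitePi fun q => expMeasure (clockRate q)

instance : IsProbabilityMeasure clocks := by
  unfold clocks; infer_instance

theorem exists_floor_moments :
    ∃ C : ℝ, 0 ≤ C ∧ ∀ q : ℕ, q.Prime →
      MemLp (fun T : ℕ → ℝ => (⌊T q⌋₊ : ℝ)) 2 clocks ∧
      ∫ T, (⌊T q⌋₊ : ℝ) ∂clocks ≤ C * (1 / q) ∧
      variance (fun T : ℕ → ℝ => (⌊T q⌋₊ : ℝ)) clocks ≤ C * (1 / q) := by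
  obtain ⟨C, hC0, hC⟩ := exists_lintegral_floor_sq_le
  refine ⟨C, hC0, fun q hq => ?_⟩
  have hm : Measurable fun T : ℕ → ℝ => (⌊T q⌋₊ : ℝ) := by fun_prop
  have hq0 : (0 : ℝ) < q := by exact_mod_cast hq.pos
  have hl : ∫⁻ T, ENNReal.ofReal ((⌊T q⌋₊ : ℝ) ^ 2) ∂clocks ≤ ENNReal.ofReal (C * (1 / q)) := by
    have h1 := (measurePreserving_eval_infinitePi (fun q => expMeasure (clockRate q)) q).lintegral_comp
      (f := fun x : ℝ => ENNReal.ofReal ((⌊x⌋₊ : ℝ) ^ 2)) (by fun_prop)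
    have h2 := hC _ (log_two_le_clockRate q)
    rw [clockRate_of_prime hq, exp_neg, exp_log hq0, ← one_div] at h2
    refine le_trans (le_of_eq h1) ?_
    rwa [clockRate_of_prime hq]
  have hm2 : AEStronglyMeasurable (fun T : ℕ → ℝ => (⌊T q⌋₊ : ℝ) ^ 2) clocks :=
    (hm.pow_const 2).aestronglyMeasurable
  have hint : Integrable (fun T : ℕ → ℝ => (⌊T q⌋₊ : ℝ) ^ 2) clocks := by
    refine ⟨hm2, ?_⟩
    rw [hasFiniteIntegral_iff_ofReal (.of_forall fun T => by positivity)]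
    exact hl.trans_lt ENNReal.ofReal_lt_top
  have hmem : MemLp (fun T : ℕ → ℝ => (⌊T q⌋₊ : ℝ)) 2 clocks :=
    (memLp_two_iff_integrable_sq hm.aestronglyMeasurable).2 hint
  have hsq : ∫ T, (⌊T q⌋₊ : ℝ) ^ 2 ∂clocks ≤ C * (1 / q) := by
    rw [integral_eq_lintegral_of_nonneg_ae (.of_forall fun T => by positivity) hm2]
    exact ENNReal.toReal_le_of_le_ofReal (by positivity) hl
  refine ⟨hmem, ?_, ?_⟩
  · refine (integral_mono (hmem.integrable one_le_two) hint fun T => ?_).trans hsq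
    show (⌊T q⌋₊ : ℝ) ≤ (⌊T q⌋₊ : ℝ) ^ 2
    exact_mod_cast Nat.le_self_pow two_ne_zero _
  · exact (variance_le_expectation_sq hm.aestronglyMeasurable).trans hsq

/-- The total exponent carried at time `1` by the primes up to `exp (exp (2 ^ j))`. -/
noncomputable def blockCount (j : ℕ) (T : ℕ → ℝ) : ℝ :=
  ∑ q ∈ (Finset.range (⌊exp (exp (2 ^ j))⌋₊ + 1)).filter Nat.Prime, (⌊T q⌋₊ : ℝ)

theorem measurable_blockCount (j : ℕ) : Measurable (blockCount j) := by
  unfold blockCount; fun_prop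

theorem exists_blockCount_moments :
    ∃ C : ℝ, 0 ≤ C ∧ ∀ j, MemLp (blockCount j) 2 clocks ∧
      ∫ T, blockCount j T ∂clocks ≤ C * 2 ^ j ∧ variance (blockCount j) clocks ≤ C * 2 ^ j := by
  obtain ⟨C, hC0, hC⟩ := exists_floor_moments
  refine ⟨C * (exp 1 * 2), by positivity, fun j => ?_⟩
  set P := (Finset.range (⌊exp (exp (2 ^ j))⌋₊ + 1)).filter Nat.Prime with hP
  have hprime : ∀ q ∈ P, q.Prime := fun q hq => (Finset.mem_filter.1 hq).2
  have hsum : C * ∑ q ∈ P, (1 / q : ℝ) ≤ C * (exp 1 * 2) * 2 ^ j := by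
    have h1 := sum_primes_inv_le (X := exp (exp (2 ^ j))) (by simpa using exp_pos _) P hprime
      fun q hq => by
        have h := Finset.mem_range.1 (Finset.mem_filter.1 hq).1
        exact (Nat.le_floor_iff (exp_pos _).le).1 (Nat.lt_succ_iff.1 h)
    have h2 : log (1 + log (exp (exp (2 ^ j)))) ≤ 2 * 2 ^ j := by
      rw [log_exp, log_le_iff_le_exp (by positivity)]
      have h3 : (1 : ℝ) ≤ 2 ^ j := one_le_pow₀ one_le_two
      have h4 : 1 + exp ((2 : ℝ) ^ j) ≤ 2 * exp (2 ^ j) := by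
        have : 1 ≤ exp ((2 : ℝ) ^ j) := one_le_exp (by positivity)
        linarith
      have h5 : (2 : ℝ) ≤ exp (2 ^ j) := by
        have := add_one_le_exp ((2 : ℝ) ^ j)
        linarith
      rw [two_mul, exp_add]
      nlinarith [exp_pos ((2 : ℝ) ^ j)]
    rw [mul_assoc]
    refine mul_le_mul_of_nonneg_left (h1.trans ?_) hC0
    rw [mul_assoc]
    exact mul_le_mul_of_nonneg_left h2 (exp_pos _).le
  have hfun : blockCount j = ∑ q ∈ P, fun T : ℕ → ℝ => (⌊T q⌋₊ : ℝ) := by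
    ext T; rw [Finset.sum_apply]; rfl
  have hmem : ∀ q ∈ P, MemLp (fun T : ℕ → ℝ => (⌊T q⌋₊ : ℝ)) 2 clocks :=
    fun q hq => (hC q (hprime q hq)).1
  have hind : iIndepFun (fun (q : ℕ) (T : ℕ → ℝ) => (⌊T q⌋₊ : ℝ)) clocks :=
    iIndepFun_infinitePi (X := fun _ x => (⌊x⌋₊ : ℝ)) (by fun_prop)
  refine ⟨?_, ?_, ?_⟩
  · rw [hfun]; exact memLp_finsetSum' _ hmem
  · have : ∫ T, blockCount j T ∂clocks = ∑ q ∈ P, ∫ T, (⌊T q⌋₊ : ℝ) ∂clocks :=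
      integral_finsetSum _ fun q hq => (hmem q hq).integrable one_le_two
    rw [this]
    refine le_trans ?_ hsum
    rw [Finset.mul_sum]
    exact Finset.sum_le_sum fun q hq => (hC q (hprime q hq)).2.1
  · rw [hfun, IndepFun.variance_sum hmem fun p _ q _ hpq => hind.indepFun hpq]
    refine le_trans ?_ hsum
    rw [Finset.mul_sum]
    exact Finset.sum_le_sum fun q hq => (hC q (hprime q hq)).2.2

theorem exists_dominating_function :
    ∃ H : (ℕ → ℝ) → ENNReal, Measurable H ∧ ∫⁻ T, H T ∂clocks ≠ ⊤ ∧
      ∀ T (x : ℝ) (S : Finset ℕ), exp (exp 1) ≤ x → (∀ n ∈ S, n ∈ reached T) →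
        (∀ n ∈ S, (n : ℝ) ≤ x) → ENNReal.ofReal (S.card / log (log x)) ≤ H T := by
  obtain ⟨C, hC0, hC⟩ := exists_blockCount_moments
  set d : ℕ → (ℕ → ℝ) → ℝ := fun j T => (blockCount j T - ∫ T, blockCount j T ∂clocks) ^ 2 / 4 ^ j
    with hd
  have hd0 : ∀ j T, 0 ≤ d j T := fun j T => by simp only [hd]; positivity
  have hdm : ∀ j, Measurable (d j) := fun j =>
    (((measurable_blockCount j).sub_const _).pow_const 2).div_const _
  refine ⟨fun T => 2 * (ENNReal.ofReal (C + 1) + ∑' j, ENNReal.ofReal (d j T)), by fun_prop, ?_, ?_⟩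
  · rw [lintegral_const_mul _ (by fun_prop), lintegral_add_left measurable_const, lintegral_const,
      lintegral_tsum fun j => (hdm j).ennreal_ofReal.aemeasurable]
    · have hvar : ∀ j, ∫⁻ T, ENNReal.ofReal (d j T) ∂clocks ≤ ENNReal.ofReal (C * (1 / 2) ^ j) := by
        intro j
        have hint : Integrable (d j) clocks :=
          (((hC j).1.sub (memLp_const _)).integrable_sq).div_const _
        rw [← ofReal_integral_eq_lintegral_ofReal hint (.of_forall (hd0 j))]
        refine ENNReal.ofReal_le_ofReal ?_
        simp only [hd]
        rw [integral_div, ← variance_eq_integral (measurable_blockCount j).aemeasurable,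
          div_le_iff₀ (by positivity)]
        refine (hC j).2.2.trans (le_of_eq ?_)
        rw [mul_assoc, ← mul_pow]; norm_num
      have hsum : ∑' j : ℕ, ENNReal.ofReal (C * (1 / 2) ^ j) ≠ ⊤ := by
        rw [← ENNReal.ofReal_tsum_of_nonneg (fun j => by positivity)
          ((summable_geometric_of_lt_one (by norm_num) (by norm_num)).mul_left C)]
        exact ENNReal.ofReal_ne_top
      have := ne_top_of_le_ne_top hsum (ENNReal.tsum_le_tsum hvar)
      refine ENNReal.mul_ne_top (by simp) (ENNReal.add_ne_top.2 ⟨?_, this⟩)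
      simp
  · intro T x S hx hS hSx
    have hx0 : 0 < x := (exp_pos _).trans_le hx
    have h1 : exp 1 ≤ log x := (le_log_iff_exp_le hx0).2 hx
    have hL0 : 0 < log x := (exp_pos _).trans_le h1
    have h2 : 1 ≤ log (log x) := (le_log_iff_exp_le hL0).2 h1
    obtain ⟨i, hi1, hi2⟩ := exists_nat_pow_near h2 one_lt_two
    set y := log (log x)
    set j := i + 1
    have hyx : x = exp (exp y) := by rw [exp_log hL0, exp_log hx0]
    have hcard : (S.card : ℝ) ≤ blockCount j T := by
      have h3 := card_le_sum_floor (N := ⌊exp (exp (2 ^ j))⌋₊) hS fun n hn => Nat.le_floor <|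
        (hSx n hn).trans <| by rw [hyx]; exact exp_le_exp.2 (exp_le_exp.2 hi2.le)
      rw [blockCount]
      exact_mod_cast h3
    have hpow : (0 : ℝ) < 2 ^ j := by positivity
    have h4 : S.card / y ≤ 2 * ((C + 1) + d j T) := by
      set m := ∫ T, blockCount j T ∂clocks with hm
      have h5 : S.card / y ≤ 2 * (blockCount j T / 2 ^ j) := by
        rw [div_le_iff₀ (by linarith)]
        have hb : 0 ≤ blockCount j T / 2 ^ j :=
          div_nonneg ((Nat.cast_nonneg _).trans hcard) hpow.le
        have h6 : (2 : ℝ) ^ j ≤ 2 * y := by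
          rw [show (2 : ℝ) ^ j = 2 * 2 ^ i from pow_succ' _ _]; linarith
        calc (S.card : ℝ) ≤ blockCount j T / 2 ^ j * 2 ^ j := by
              rwa [div_mul_cancel₀ _ hpow.ne']
          _ ≤ blockCount j T / 2 ^ j * (2 * y) := by gcongr
          _ = _ := by ring
      refine h5.trans (mul_le_mul_of_nonneg_left ?_ two_pos.le)
      have h7 : d j T = ((blockCount j T - m) / 2 ^ j) ^ 2 := by
        simp only [hd, ← hm]
        rw [div_pow, ← pow_mul, mul_comm j 2, pow_mul]; norm_num
      have h8 : m / 2 ^ j ≤ C := (div_le_iff₀ hpow).2 (hC j).2.1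
      have h9 : blockCount j T / 2 ^ j = m / 2 ^ j + (blockCount j T - m) / 2 ^ j := by ring
      rw [h7, h9]
      nlinarith [sq_nonneg ((blockCount j T - m) / 2 ^ j - 1)]
    refine (ENNReal.ofReal_le_ofReal h4).trans ?_
    rw [ENNReal.ofReal_mul two_pos.le, ENNReal.ofReal_add (by positivity) (hd0 j T)]
    simp only [ENNReal.ofReal_ofNat]
    gcongr
    exact ENNReal.le_tsum j

theorem measurableSet_reachedVia (n p : ℕ) : MeasurableSet {T | ReachedVia T n p} := by
  simp only [ReachedVia, Set.ofPred_and, Set.ofPred_forall, Set.mem_Ioo]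
  refine .inter (measurableSet_lt measurable_const (measurable_pi_apply p)) ?_
  refine .iInter fun q => .iInter fun _ => .iInter fun _ => .inter ?_ ?_
  · exact measurableSet_lt (by fun_prop) (measurable_pi_apply q)
  · exact measurableSet_lt (measurable_pi_apply q) (by fun_prop)

theorem reached_eq_biUnion (n : ℕ) :
    {T | n ∈ reached T} = ⋃ p ∈ n.primeFactors, {T | ReachedVia T n p} := by
  ext T; simp [reached]

theorem measurableSet_mem_reached (n : ℕ) : MeasurableSet {T | n ∈ reached T} := by
  rw [reached_eq_biUnion]
  exact Finset.measurableSet_biUnion _ fun p _ => measurableSet_reachedVia n p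

theorem disjoint_reachedVia {n p q : ℕ} (hp : p ∈ n.primeFactors) (hq : q ∈ n.primeFactors)
    (hpq : p ≠ q) : Disjoint {T | ReachedVia T n p} {T | ReachedVia T n q} := by
  rw [Set.disjoint_left]
  intro T h1 h2
  have ha : (0 : ℝ) < n.factorization p := by
    exact_mod_cast factorization_pos_of_mem_primeFactors hp
  have hb : (0 : ℝ) < n.factorization q := by
    exact_mod_cast factorization_pos_of_mem_primeFactors hq
  have h3 := (h1.2 q (Nat.prime_of_mem_primeFactors hq) hpq.symm).1
  have h4 := (h2.2 p (Nat.prime_of_mem_primeFactors hp) hpq).1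
  rw [mul_comm, ← lt_div_iff₀ hb] at h3
  rw [mul_comm, ← lt_div_iff₀ ha] at h4
  exact lt_asymm h3 h4

theorem sum_factorization_mul_log_le {n p : ℕ} (S : Finset ℕ) (hpS : p ∉ S) :
    ∑ q ∈ S, (n.factorization q : ℝ) * log q ≤ log n - n.factorization p * log p := by
  have h1 : log n = ∑ q ∈ n.primeFactors, (n.factorization q : ℝ) * log q := by
    rw [Real.log_nat_eq_sum_factorization, Finsupp.sum, Nat.support_factorization]
  have h0 : ∀ q : ℕ, 0 ≤ (n.factorization q : ℝ) * log q := fun q =>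
    mul_nonneg (Nat.cast_nonneg _) (log_natCast_nonneg q)
  have h2 : ∑ q ∈ insert p S, (n.factorization q : ℝ) * log q ≤ log n := by
    rw [h1, Finset.sum_subset (s₁ := n.primeFactors) (s₂ := insert p S ∪ n.primeFactors)
      Finset.subset_union_right fun q _ hq => by
        rw [← Nat.support_factorization, Finsupp.notMem_support_iff] at hq
        simp [hq]]
    exact Finset.sum_le_sum_of_subset_of_nonneg Finset.subset_union_left fun q _ _ => h0 q
  rw [Finset.sum_insert hpS] at h2
  linarith

theorem le_clocks_pi_Ioo (n p : ℕ) {t : ℝ} (ht : 1 < t) :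
    ENNReal.ofReal (exp (-(t * (log n - n.factorization p * log p))) * ((t - 1) / t)) ≤
      clocks (Set.pi {q | q.Prime ∧ q ≠ p} fun q =>
        Set.Ioo (n.factorization q * t) ((n.factorization q + 1) * t)) := by
  rw [clocks, Measure.infinitePi_pi_of_countable _ (Set.to_countable _)
    fun q _ => measurableSet_Ioo, ENNReal.tprod_eq_iInf_prod fun q => prob_le_one]
  refine le_iInf fun s => ?_
  set S := s.map (Function.Embedding.subtype _) with hSdef
  have hS : ∀ q ∈ S, q.Prime ∧ q ≠ p := fun q hq => by
    obtain ⟨r, -, rfl⟩ := Finset.mem_map.1 hq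
    exact r.2
  have hprod := Finset.prod_map s (Function.Embedding.subtype _) fun q : ℕ =>
    expMeasure (clockRate q) (Set.Ioo (n.factorization q * t) ((n.factorization q + 1) * t))
  refine le_trans ?_ (le_of_eq hprod)
  rw [← hSdef]
  have hfac : ∀ q ∈ S, expMeasure (clockRate q)
      (Set.Ioo (n.factorization q * t) ((n.factorization q + 1) * t)) =
      ENNReal.ofReal (exp (-(t * (n.factorization q * log q))) * (1 - (q : ℝ) ^ (-t))) := by
    intro q hq
    have hq0 : (0 : ℝ) < q := by exact_mod_cast (hS q hq).1.pos
    rw [expMeasure_Ioo (clockRate_pos q) (by positivity) (by gcongr; linarith),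
      clockRate_of_prime (hS q hq).1, Real.rpow_def_of_pos hq0, mul_sub, mul_one, ← exp_add]
    congr 3 <;> ring_nf
  rw [Finset.prod_congr rfl hfac, ← ENNReal.ofReal_prod_of_nonneg, Finset.prod_mul_distrib,
    ← exp_sum, Finset.sum_neg_distrib, ← Finset.mul_sum]
  · refine ENNReal.ofReal_le_ofReal (mul_le_mul ?_ (le_prod_one_sub_rpow_neg ht S
      fun q hq => (hS q hq).1) (div_nonneg (by linarith) (by linarith)) (exp_pos _).le)
    refine exp_le_exp.2 (neg_le_neg (mul_le_mul_of_nonneg_left ?_ (by linarith)))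
    exact sum_factorization_mul_log_le S fun h => (hS p h).2 rfl
  · intro q hq
    refine mul_nonneg (exp_pos _).le (sub_nonneg.2 ?_)
    exact (Real.rpow_lt_one_of_one_lt_of_neg
        (by exact_mod_cast (hS q hq).1.one_lt) (by linarith)).le

theorem integral_exp_mul_sub_sq_ge {L a : ℝ} (l : ℝ) (hl : 0 ≤ l) (hL : 0 < L) (ha : 0 < a) :
    l * a * (exp (-L) * (1 / L ^ 2 - 2 / L ^ 3)) ≤
      ∫ x in a..2 * a, l * exp (-(L * (x / a))) * ((x / a - 1) - (x / a - 1) ^ 2) := by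
  set F : ℝ → ℝ := fun x => l * a * (exp (-(L * (x / a))) *
    ((x / a - 1) ^ 2 / L + (2 / L ^ 2 - 1 / L) * (x / a - 1) + (2 / L ^ 3 - 1 / L ^ 2))) with hF
  have hderiv : ∀ x ∈ Set.uIcc a (2 * a), HasDerivAt F
      (l * exp (-(L * (x / a))) * ((x / a - 1) - (x / a - 1) ^ 2)) x := by
    intro x _
    have hu : HasDerivAt (fun x : ℝ => x / a) (1 / a) x := (hasDerivAt_id x).div_const a
    have he := (hu.const_mul L).neg.exp
    have hv := hu.sub_const 1
    have hp := (((hv.pow 2).div_const L).add (hv.const_mul (2 / L ^ 2 - 1 / L))).add_const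
      (2 / L ^ 3 - 1 / L ^ 2)
    convert! (he.mul hp).const_mul (l * a) using 1
    simp
    field_simp
    ring
  rw [intervalIntegral.integral_eq_sub_of_hasDerivAt hderiv
    (Continuous.intervalIntegrable (by fun_prop) _ _)]
  have h1 : 2 * a / a = 2 := by field_simp
  have h2 : a / a = 1 := div_self ha.ne'
  simp only [hF, h1, h2]
  have h3 : 0 ≤ l * a * (exp (-(L * 2)) * (1 / L ^ 2 + 2 / L ^ 3)) := by positivity
  have h4 : (2 - 1 : ℝ) ^ 2 / L + (2 / L ^ 2 - 1 / L) * (2 - 1) + (2 / L ^ 3 - 1 / L ^ 2)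
      = 1 / L ^ 2 + 2 / L ^ 3 := by ring
  have h5 : (1 - 1 : ℝ) ^ 2 / L + (2 / L ^ 2 - 1 / L) * (1 - 1) + (2 / L ^ 3 - 1 / L ^ 2)
      = -(1 / L ^ 2 - 2 / L ^ 3) := by ring
  rw [h4, h5, mul_one]
  linarith

theorem le_clocks_reachedVia {n p : ℕ} (hp : p ∈ n.primeFactors) :
    ENNReal.ofReal (n.factorization p * log p * (1 / n * (1 / log n ^ 2 - 2 / log n ^ 3))) ≤
      clocks {T | ReachedVia T n p} := by
  have hpp := Nat.prime_of_mem_primeFactors hp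
  have hn0 : n ≠ 0 := by rintro rfl; simp at hp
  have hn1 : 1 < n := hpp.one_lt.trans_le (Nat.le_of_mem_primeFactors hp)
  have ha : (0 : ℝ) < n.factorization p := by
    exact_mod_cast factorization_pos_of_mem_primeFactors hp
  have hl : 0 < log p := log_pos (by exact_mod_cast hpp.one_lt)
  have hL : 0 < log n := log_pos (by exact_mod_cast hn1)
  set a : ℝ := (n.factorization p : ℝ) with ha_def
  set L : ℝ := log n with hL_def
  set ψ : ℝ → ℝ := fun x =>
    exp (-(x / a * (L - a * log p))) * ((x / a - 1) - (x / a - 1) ^ 2) with hψ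
  have hmp := measurePreserving_update_infinitePi (fun q => expMeasure (clockRate q)) p
  have hB := measurableSet_reachedVia n p
  have hslice : clocks {T | ReachedVia T n p} =
      ∫⁻ x, clocks {T | ReachedVia (Function.update T p x) n p} ∂expMeasure (clockRate p) := by
    rw [clocks, ← hmp.measure_preimage hB.nullMeasurableSet,
      Measure.prod_apply (hmp.measurable hB)]
    rfl
  have hpt : ∀ x ∈ Set.Ioc a (2 * a),
      ENNReal.ofReal (ψ x) ≤ clocks {T | ReachedVia (Function.update T p x) n p} := by
    intro x hx
    have ht : 1 < x / a := (one_lt_div ha).2 hx.1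
    have hset : {T | ReachedVia (Function.update T p x) n p} =
        Set.pi {q | q.Prime ∧ q ≠ p} fun q =>
          Set.Ioo (n.factorization q * (x / a)) ((n.factorization q + 1) * (x / a)) := by
      ext T
      simp only [ReachedVia, Function.update_self, Set.mem_pi, Set.mem_ofPred_eq, and_imp]
      refine (and_iff_right hx.1).trans (forall_congr' fun q => forall₂_congr fun _ hq => ?_)
      rw [Function.update_of_ne hq]
    rw [hset]
    refine le_trans (ENNReal.ofReal_le_ofReal ?_) (le_clocks_pi_Ioo n p ht)
    refine mul_le_mul_of_nonneg_left ?_ (exp_pos _).le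
    rw [le_div_iff₀ (by linarith)]
    nlinarith [pow_pos (sub_pos.2 ht) 3]
  have hψm : Measurable fun x => ENNReal.ofReal (ψ x) := by fun_prop
  have hpdf : ∫⁻ x in Set.Ioc a (2 * a), ENNReal.ofReal (ψ x) ∂expMeasure (clockRate p) =
      ENNReal.ofReal (∫ x in a..2 * a,
        log p * exp (-(L * (x / a))) * ((x / a - 1) - (x / a - 1) ^ 2)) := by
    have h0 : ∀ x ∈ Set.Ioc a (2 * a), exponentialPDF (log p) x * ENNReal.ofReal (ψ x) =
        ENNReal.ofReal (log p * exp (-(L * (x / a))) * ((x / a - 1) - (x / a - 1) ^ 2)) := by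
      intro x hx
      have hx0 : 0 ≤ x := ha.le.trans hx.1.le
      rw [exponentialPDF_of_nonneg hx0, ← ENNReal.ofReal_mul (by positivity), hψ]
      congr 1
      have : exp (-(L * (x / a))) = exp (-(log p * x)) * exp (-(x / a * (L - a * log p))) := by
        rw [← exp_add]; congr 1; field_simp; ring
      rw [this]; ring
    rw [intervalIntegral.integral_of_le (by linarith), ofReal_integral_eq_lintegral_ofReal,
      clockRate_of_prime hpp, expMeasure, gammaMeasure,
      setLIntegral_withDensity_eq_setLIntegral_mul _
        (show Measurable (gammaPDF 1 (log p)) from (measurable_gammaPDFReal 1 (log p)).ennreal_ofReal) hψm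
        measurableSet_Ioc]
    · exact setLIntegral_congr_fun measurableSet_Ioc h0
    · exact (Continuous.integrableOn_Ioc (by fun_prop))
    · refine (ae_restrict_iff' measurableSet_Ioc).2 (.of_forall fun x hx => ?_)
      have h1 : 1 < x / a := (one_lt_div ha).2 hx.1
      have h2 : x / a ≤ 2 := (div_le_iff₀ ha).2 hx.2
      refine mul_nonneg (by positivity) ?_
      nlinarith
  have hexp : (1 / n : ℝ) = exp (-L) := by
    rw [exp_neg, exp_log (by positivity), one_div]
  calc _ ≤ ENNReal.ofReal (∫ x in a..2 * a,
        log p * exp (-(L * (x / a))) * ((x / a - 1) - (x / a - 1) ^ 2)) := by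
        refine ENNReal.ofReal_le_ofReal (le_trans (le_of_eq ?_)
          (integral_exp_mul_sub_sq_ge _ hl.le hL ha))
        rw [hexp]; ring
    _ = ∫⁻ x in Set.Ioc a (2 * a), ENNReal.ofReal (ψ x) ∂expMeasure (clockRate p) := hpdf.symm
    _ ≤ ∫⁻ x in Set.Ioc a (2 * a), clocks {T | ReachedVia (Function.update T p x) n p}
          ∂expMeasure (clockRate p) := setLIntegral_mono' measurableSet_Ioc hpt
    _ ≤ _ := by rw [hslice]; exact setLIntegral_le_lintegral _ _

theorem le_clocks_mem_reached {n : ℕ} (hn : 2 ≤ n) :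
    ENNReal.ofReal (1 / (n * log n) * (1 - 2 / log n)) ≤ clocks {T | n ∈ reached T} := by
  have hL : 0 < log n := log_pos (by exact_mod_cast hn)
  have hn0 : (0 : ℝ) < n := by positivity
  rcases le_total (1 - 2 / log n) 0 with h | h
  · rw [ENNReal.ofReal_of_nonpos (mul_nonpos_of_nonneg_of_nonpos (by positivity) h)]
    exact zero_le
  have h1 : log n = ∑ q ∈ n.primeFactors, (n.factorization q : ℝ) * log q := by
    rw [Real.log_nat_eq_sum_factorization, Finsupp.sum, Nat.support_factorization]
  have h2 : 1 / (n * log n) * (1 - 2 / log n) = ∑ p ∈ n.primeFactors,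
      n.factorization p * log p * (1 / n * (1 / log n ^ 2 - 2 / log n ^ 3)) := by
    rw [← Finset.sum_mul, ← h1]; field_simp
  have h3 : 0 ≤ 1 / (n : ℝ) * (1 / log n ^ 2 - 2 / log n ^ 3) := by
    have : 1 / log n ^ 2 - 2 / log n ^ 3 = 1 / log n ^ 2 * (1 - 2 / log n) := by field_simp
    rw [this]; positivity
  rw [h2, ENNReal.ofReal_sum_of_nonneg fun p _ =>
      mul_nonneg (mul_nonneg (Nat.cast_nonneg _) (log_natCast_nonneg p)) h3,
    reached_eq_biUnion, measure_biUnion_finset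
      (fun p hp q hq hpq => disjoint_reachedVia hp hq hpq) fun p _ => measurableSet_reachedVia n p]
  exact Finset.sum_le_sum fun p hp => le_clocks_reachedVia hp

open Classical in
/-- The elements `n ≥ 2` of `A` that are at most `x`. -/
noncomputable def upTo (A : Set ℕ) (x : ℝ) : Finset ℕ := (Finset.Icc 2 ⌊x⌋₊).filter (· ∈ A)

theorem mem_upTo {A : Set ℕ} {x : ℝ} {n : ℕ} : n ∈ upTo A x ↔ 2 ≤ n ∧ (n : ℝ) ≤ x ∧ n ∈ A := by
  simp only [upTo, Finset.mem_filter, Finset.mem_Icc, and_assoc]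
  refine and_congr_right fun hn => and_congr_left fun _ => Nat.le_floor_iff' (by omega)

theorem tsum_eq_sum_upTo {A : Set ℕ} (h1 : 1 ∉ A) (x : ℝ) {f : ℕ → ℝ} (hf : f 0 = 0) :
    ∑' a : {a : ℕ // a ∈ A ∧ (a : ℝ) ≤ x}, f a = ∑ a ∈ upTo A x, f a := by
  rw [show ∑' a : {a : ℕ // a ∈ A ∧ (a : ℝ) ≤ x}, f a = _ from
    tsum_subtype {a : ℕ | a ∈ A ∧ (a : ℝ) ≤ x} f, tsum_eq_sum (s := upTo A x)]
  · refine Finset.sum_congr rfl fun a ha => Set.indicator_of_mem ?_ _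
    exact ⟨(mem_upTo.1 ha).2.2, (mem_upTo.1 ha).2.1⟩
  · intro a ha
    by_cases h : a ∈ {a : ℕ | a ∈ A ∧ (a : ℝ) ≤ x}
    · have ha2 : ¬ 2 ≤ a := fun h2 => ha (mem_upTo.2 ⟨h2, h.2, h.1⟩)
      have ha1 : a ≠ 1 := fun h' => h1 (h' ▸ h.1)
      obtain rfl : a = 0 := by omega
      rw [Set.indicator_of_mem h, hf]
    · exact Set.indicator_of_notMem h _

theorem exists_sub_le_sum_clocks {ε : ℝ} (hε : 0 < ε) :
    ∃ C : ℝ, ∀ S : Finset ℕ, (∀ n ∈ S, 2 ≤ n) →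
      (1 - ε) * ∑ n ∈ S, 1 / (n * log n) - C ≤ ∑ n ∈ S, clocks.real {T | n ∈ reached T} := by
  set N := ⌈exp (2 / ε)⌉₊
  have hg : ∀ n : ℕ, 0 ≤ 1 / (n * log n) * (2 / log n) := fun n => by
    have := log_natCast_nonneg n
    positivity
  refine ⟨∑ n ∈ Finset.range N, 1 / (n * log n) * (2 / log n), fun S hS => ?_⟩
  have h1 : ∑ n ∈ S with n < N, 1 / (n * log n) * (2 / log n) ≤
      ∑ n ∈ Finset.range N, 1 / (n * log n) * (2 / log n) :=
    Finset.sum_le_sum_of_subset_of_nonneg (fun n hn => by simp at hn ⊢; exact hn.2)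
      fun n _ _ => hg n
  rw [Finset.sum_filter] at h1
  refine (sub_le_sub_left h1 _).trans ?_
  rw [Finset.mul_sum, ← Finset.sum_sub_distrib]
  refine Finset.sum_le_sum fun n hn => ?_
  have hn2 : (2 : ℝ) ≤ n := by exact_mod_cast hS n hn
  have hL : 0 < log n := log_pos (by linarith)
  have h2 : 1 / (n * log n) * (1 - 2 / log n) ≤ clocks.real {T | n ∈ reached T} :=
    (ENNReal.ofReal_le_iff_le_toReal (measure_ne_top _ _)).1 (le_clocks_mem_reached (hS n hn))
  refine le_trans ?_ h2
  have h3 : 0 ≤ 1 / (n * log n) := by positivity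
  split_ifs with h
  · nlinarith
  · have h4 : 2 / ε ≤ log n := by
      rw [le_log_iff_exp_le (by linarith)]
      exact (Nat.le_ceil _).trans (by exact_mod_cast not_lt.1 h)
    have h5 : 2 / log n ≤ ε := by
      rw [div_le_iff₀ hL]
      rwa [div_le_iff₀ hε, mul_comm] at h4
    nlinarith

theorem card_upTo_inter_reached (A : Set ℕ) (x : ℝ) (T : ℕ → ℝ) :
    ((upTo (A ∩ reached T) x).card : ENNReal) =
      ∑ n ∈ upTo A x, {T | n ∈ reached T}.indicator (fun _ => 1) T := by
  classical
  have : upTo (A ∩ reached T) x = (upTo A x).filter (· ∈ reached T) := by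
    ext n
    simp [mem_upTo, and_assoc]
  rw [this, Finset.card_filter, Nat.cast_sum]
  refine Finset.sum_congr rfl fun n _ => ?_
  by_cases h : n ∈ reached T <;> simp [h]

theorem measurable_card_upTo_inter_reached (A : Set ℕ) (x : ℝ) :
    Measurable fun T => ((upTo (A ∩ reached T) x).card : ENNReal) := by
  simp_rw [card_upTo_inter_reached]
  exact Finset.measurable_sum _ fun n _ =>
    measurable_const.indicator (measurableSet_mem_reached n)

theorem lintegral_card_upTo_inter_reached (A : Set ℕ) (x : ℝ) :
    ∫⁻ T, ((upTo (A ∩ reached T) x).card : ENNReal) ∂clocks =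
      ENNReal.ofReal (∑ n ∈ upTo A x, clocks.real {T | n ∈ reached T}) := by
  simp_rw [card_upTo_inter_reached]
  rw [lintegral_finsetSum _ fun n _ => measurable_const.indicator (measurableSet_mem_reached n),
    ENNReal.ofReal_sum_of_nonneg fun _ _ => measureReal_nonneg]
  refine Finset.sum_congr rfl fun n _ => ?_
  rw [lintegral_indicator_const (measurableSet_mem_reached n), one_mul, ofReal_measureReal]

theorem exists_clock_frequently_lt_card {A : Set ℕ} {D : ℝ} {x : ℕ → ℝ}
    (hx : Tendsto x atTop atTop) (hx' : ∀ k, exp (exp 1) ≤ x k)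
    (hD : ∀ c < D, ∀ᶠ k in atTop, c < (∑ n ∈ upTo A (x k), 1 / (n * log n)) / log (log (x k))) :
    ∃ T M, (∀ y, exp (exp 1) ≤ y → (upTo (A ∩ reached T) y).card / log (log y) ≤ M) ∧
      ∀ c < D, 0 ≤ c → ∃ᶠ k in atTop, c < (upTo (A ∩ reached T) (x k)).card / log (log (x k)) := by
  obtain ⟨H, hHm, hH, hbound⟩ := exists_dominating_function
  have hl : ∀ k, 0 < log (log (x k)) := fun k => by
    have h0 := (exp_pos _).trans_le (hx' k)
    have h1 : exp 1 ≤ log (x k) := (le_log_iff_exp_le h0).2 (hx' k)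
    have h2 : 1 ≤ log (log (x k)) := (le_log_iff_exp_le ((exp_pos _).trans_le h1)).2 h1
    linarith
  set f : ℕ → (ℕ → ℝ) → ENNReal := fun k T =>
    ENNReal.ofReal ((upTo (A ∩ reached T) (x k)).card / log (log (x k))) with hf
  have hf' : ∀ k T, f k T = ((upTo (A ∩ reached T) (x k)).card : ENNReal) *
      ENNReal.ofReal (1 / log (log (x k))) := fun k T => by
    simp only [hf]
    rw [div_eq_mul_one_div, ENNReal.ofReal_mul (Nat.cast_nonneg _), ENNReal.ofReal_natCast]
  have hle : ∀ T y, exp (exp 1) ≤ y →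
      ENNReal.ofReal ((upTo (A ∩ reached T) y).card / log (log y)) ≤ H T := fun T y hy =>
    hbound T y _ hy (fun n hn => (mem_upTo.1 hn).2.2.2) fun n hn => (mem_upTo.1 hn).2.1
  have hint : ∀ k, ∫⁻ T, f k T ∂clocks = ENNReal.ofReal
      ((∑ n ∈ upTo A (x k), clocks.real {T | n ∈ reached T}) / log (log (x k))) := fun k => by
    simp_rw [hf']
    rw [lintegral_mul_const _ (measurable_card_upTo_inter_reached _ _),
      lintegral_card_upTo_inter_reached, ← ENNReal.ofReal_mul
        (Finset.sum_nonneg fun _ _ => measureReal_nonneg), mul_one_div]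
  have hfatou := limsup_lintegral_le (μ := clocks) H
    (f := f) (fun k => by
      rw [show f k = _ from funext (hf' k)]
      exact (measurable_card_upTo_inter_reached _ _).mul_const _)
    (fun k => .of_forall fun T => hle T _ (hx' k)) hH
  have hlog : Tendsto (fun k => log (log (x k))) atTop atTop :=
    tendsto_log_atTop.comp (tendsto_log_atTop.comp hx)
  have hlower : ENNReal.ofReal D ≤ limsup (fun k => ∫⁻ T, f k T ∂clocks) atTop := by
    refine le_of_forall_lt fun b hb => ?_
    obtain ⟨c, rfl⟩ : ∃ c : NNReal, b = c := ⟨b.toNNReal, (ENNReal.coe_toNNReal hb.ne_top).symm⟩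
    have hcD : (c : ℝ) < D := by
      rw [← ENNReal.ofReal_coe_nnreal] at hb
      exact (ENNReal.ofReal_lt_ofReal_iff_of_nonneg c.2).1 hb
    obtain ⟨c₁, hc₁, hc₁D⟩ := exists_between hcD
    obtain ⟨c₂, hc₂, hc₂D⟩ := exists_between hc₁D
    have hc0 : (0 : ℝ) ≤ c := c.2
    have hc₂0 : 0 < c₂ := by linarith
    set ε := (c₂ - c₁) / (2 * c₂) with hε
    have hε0 : 0 < ε := div_pos (by linarith) (by linarith)
    have hε2 : ε * c₂ = (c₂ - c₁) / 2 := by rw [hε]; field_simp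
    have hε1 : ε < 1 := by rw [hε, div_lt_one (by linarith)]; linarith
    obtain ⟨C, hC⟩ := exists_sub_le_sum_clocks hε0
    have hC' : ∀ᶠ k in atTop, C / log (log (x k)) < (c₂ - c₁) / 2 :=
      (hlog.const_div_atTop C).eventually_lt_const (by linarith)
    have key : ENNReal.ofReal c₁ ≤ limsup (fun k => ∫⁻ T, f k T ∂clocks) atTop := by
      refine le_limsup_of_frequently_le (Eventually.frequently ?_)
      filter_upwards [hC', hD c₂ hc₂D] with k hk1 hk2
      rw [hint]
      refine ENNReal.ofReal_le_ofReal ?_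
      have h1 := div_le_div_of_nonneg_right (hC (upTo A (x k)) fun n hn => (mem_upTo.1 hn).1)
        (hl k).le
      rw [sub_div, mul_div_assoc] at h1
      refine le_trans ?_ h1
      nlinarith
    refine lt_of_lt_of_le ?_ key
    rw [← ENNReal.ofReal_coe_nnreal]
    exact (ENNReal.ofReal_lt_ofReal_iff_of_nonneg hc0).2 hc₁
  have hnull : clocks {T | H T = ⊤} = 0 := by
    have := ae_lt_top hHm hH
    rw [ae_iff] at this
    simpa using this
  have hfin : ∫⁻ T, limsup (fun k => f k T) atTop ∂clocks ≠ ⊤ :=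
    ne_top_of_le_ne_top hH <| lintegral_mono fun T => limsup_le_of_le (by isBoundedDefault) <|
      .of_forall fun k => hle T _ (hx' k)
  obtain ⟨T, hT, hT'⟩ := exists_notMem_null_lintegral_le hfin hnull
  refine ⟨T, (H T).toReal, fun y hy => ?_, fun c hc hc0 => ?_⟩
  · exact (ENNReal.ofReal_le_iff_le_toReal hT).1 (hle T y hy)
  · have h1 : ENNReal.ofReal c < limsup (fun k => f k T) atTop :=
      ((ENNReal.ofReal_lt_ofReal_iff_of_nonneg hc0).2 hc).trans_le
        (hlower.trans (hfatou.trans hT'))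
    exact (frequently_lt_of_lt_limsup (by isBoundedDefault) h1).mono fun k hk =>
      (ENNReal.ofReal_lt_ofReal_iff_of_nonneg hc0).1 hk

theorem nat_card_nth_le {V : Set ℕ} (hV : V.Infinite) (hV2 : ∀ n ∈ V, 2 ≤ n) (x : ℝ) :
    Nat.card {i : ℕ | (Nat.nth (· ∈ V) i : ℝ) ≤ x} = (upTo V x).card := by
  have hinj : Function.Injective (Nat.nth (· ∈ V)) := Nat.nth_injective hV
  rw [← Nat.card_image_of_injective hinj, Nat.card_coe_set_eq, ← Set.ncard_coe_finset]
  congr 1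
  ext n
  simp only [Set.mem_image, Set.mem_ofPred_eq, Finset.mem_coe, mem_upTo]
  constructor
  · rintro ⟨i, hi, rfl⟩
    have := Nat.nth_mem_of_infinite hV i
    exact ⟨hV2 _ this, hi, this⟩
  · rintro ⟨-, hn, hnV⟩
    obtain ⟨i, rfl⟩ : n ∈ Set.range (Nat.nth (· ∈ V)) := (Nat.range_nth_of_infinite hV).ge hnV
    exact ⟨i, hn, rfl⟩

theorem erdos_1217 (A : Set ℕ) (h1 : 1 ∉ A) (Δ : ℝ)
    (hΔ : Δ = Filter.limsup (fun x : ℝ =>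
        (∑' a : {a : ℕ // a ∈ A ∧ (a : ℝ) ≤ x},
          1 / (((a : ℕ) : ℝ) * Real.log ((a : ℕ) : ℝ))) / Real.log (Real.log x))
        Filter.atTop)
    (hpos : 0 < Δ) :
    ∃ n : ℕ → ℕ, (∀ i, n i ∈ A) ∧ (∀ i, n i ∣ n (i + 1)) ∧ (∀ i, n i < n (i + 1)) ∧
      Δ ≤ Filter.limsup (fun x : ℝ =>
        (Nat.card {i : ℕ | ((n i : ℕ) : ℝ) ≤ x} : ℝ) / Real.log (Real.log x))
        Filter.atTop := by
  set u : ℝ → ℝ := fun x => (∑ a ∈ upTo A x, 1 / (a * log a)) / log (log x) with hu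
  have hΔu : Δ = limsup u atTop := by
    rw [hΔ]
    congr 1
    ext x
    simp only [hu]
    rw [← tsum_eq_sum_upTo h1 x (f := fun a : ℕ => 1 / (a * log a)) (by simp)]
  have hlog : Tendsto (fun x : ℝ => log (log x)) atTop atTop :=
    tendsto_log_atTop.comp tendsto_log_atTop
  have hu0 : ∀ᶠ x in atTop, 0 ≤ u x := by
    filter_upwards [hlog.eventually_ge_atTop 0] with x hx
    refine div_nonneg (Finset.sum_nonneg fun a _ => ?_) hx
    have := log_natCast_nonneg a
    positivity
  have hex : ∀ k : ℕ, ∃ x, max (exp (exp 1)) k ≤ x ∧ Δ - 1 / (k + 1) < u x := fun k => by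
    have hk : Δ - 1 / (k + 1) < limsup u atTop := by
      have : (0 : ℝ) < 1 / (k + 1) := by positivity
      linarith
    have := frequently_lt_of_lt_limsup (IsBoundedUnder.isCoboundedUnder_le ⟨0, hu0⟩) hk
    exact ((eventually_ge_atTop _).and_frequently this).exists
  choose x hx hxu using hex
  have hxt : Tendsto x atTop atTop :=
    tendsto_atTop_mono (fun k => (le_max_right _ _).trans (hx k)) tendsto_natCast_atTop_atTop
  obtain ⟨T, M, hM, hT⟩ := exists_clock_frequently_lt_card (A := A) (D := Δ) hxt
    (fun k => (le_max_left _ _).trans (hx k)) fun c hc => by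
      filter_upwards [tendsto_one_div_add_atTop_nhds_zero_nat.eventually_lt_const
        (sub_pos.2 hc)] with k hk
      have := hxu k
      simp only [hu] at this
      linarith
  set V := A ∩ reached T with hVdef
  have hV2 : ∀ n ∈ V, 2 ≤ n := fun n hn => two_le_of_mem_reached hn.2
  have hV : V.Infinite := by
    intro hfin
    have hcard : ∀ y, (upTo V y).card ≤ V.ncard := fun y => by
      rw [← Set.ncard_coe_finset]
      exact Set.ncard_le_ncard (fun n hn => (mem_upTo.1 hn).2.2) hfin
    have h2 := ((hlog.comp hxt).const_div_atTop (V.ncard : ℝ)).eventually_lt_const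
      (half_pos hpos)
    obtain ⟨k, hk1, hk2, hk3⟩ := ((hT (Δ / 2) (by linarith) (by linarith)).and_eventually
      (h2.and ((hlog.comp hxt).eventually_ge_atTop 0))).exists
    have : ((upTo V (x k)).card : ℝ) / log (log (x k)) ≤ V.ncard / log (log (x k)) :=
      div_le_div_of_nonneg_right (by exact_mod_cast hcard _) hk3
    exact absurd (hk1.trans_le this) (not_lt.2 hk2.le)
  have hmem : ∀ i, Nat.nth (· ∈ V) i ∈ V := Nat.nth_mem_of_infinite hV
  have hmono : StrictMono (Nat.nth (· ∈ V)) := Nat.nth_strictMono hV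
  refine ⟨Nat.nth (· ∈ V), fun i => (hmem i).1, fun i => ?_, fun i => hmono (Nat.lt_succ_self i), ?_⟩
  · refine (dvd_or_dvd_of_mem_reached (hmem i).2 (hmem (i + 1)).2).resolve_right fun h => ?_
    have h2 := hV2 _ (hmem i)
    exact (hmono (Nat.lt_succ_self i)).not_ge (Nat.le_of_dvd (by omega) h)
  · simp_rw [nat_card_nth_le hV hV2]
    refine le_of_forall_lt_imp_le_of_dense fun c hc => ?_
    refine le_limsup_of_frequently_le ?_ ⟨M, eventually_map.2 ?_⟩
    · refine hxt.frequently ((hT (max c 0) (max_lt hc hpos) (le_max_right _ _)).mono fun k hk => ?_)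
      exact (le_max_left _ _).trans hk.le
    · filter_upwards [eventually_ge_atTop (exp (exp 1))] with y hy using hM y hy
end

section
/- For every real $u > 0$, one has $\sum_{q \geq 2} \frac{\Lambda(q)}{q^{1+u}} \leq \frac{\log 2}{2^u - 1} \leq \frac{1}{u}$, where $\Lambda$ is the von Mangoldt function. -/
open LSeries in
lemma LSeries_ofReal_eq_tsum (f : ℕ → ℝ) {s : ℝ} (hs : s ≠ 0) :
    LSeries (fun n ↦ (f n : ℂ)) s = ((∑' n : ℕ, f n / (n : ℝ) ^ s : ℝ) : ℂ) := by
  rw [LSeries, Complex.ofReal_tsum]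
  refine tsum_congr fun n ↦ ?_
  rcases eq_or_ne n 0 with rfl | hn
  · simp [Real.zero_rpow hs]
  · rw [term_of_ne_zero hn, Complex.ofReal_div, Complex.ofReal_cpow n.cast_nonneg,
      Complex.ofReal_natCast]

lemma tsum_vonMangoldt_mul_tsum_one {s : ℝ} (hs : 1 < s) :
    (∑' n : ℕ, ArithmeticFunction.vonMangoldt n / (n : ℝ) ^ s) * (∑' n : ℕ, 1 / (n : ℝ) ^ s) =
      ∑' n : ℕ, Real.log n / (n : ℝ) ^ s := by
  have hs' : 1 < (s : ℂ).re := by simpa using hs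
  have hs0 : s ≠ 0 := by positivity
  have h := LSeries_convolution' (ArithmeticFunction.LSeriesSummable_vonMangoldt hs')
    (LSeriesSummable_one_iff.mpr hs')
  rw [ArithmeticFunction.convolution_vonMangoldt_const_one] at h
  have hlog : (fun n : ℕ ↦ Complex.log n) = fun n : ℕ ↦ ((Real.log n : ℝ) : ℂ) := by
    ext n; simp
  have hone : (1 : ℕ → ℂ) = fun _ : ℕ ↦ ((1 : ℝ) : ℂ) := by ext n; simp
  rw [hlog, hone, LSeries_ofReal_eq_tsum _ hs0, LSeries_ofReal_eq_tsum _ hs0,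
    LSeries_ofReal_eq_tsum _ hs0] at h
  exact_mod_cast h.symm

lemma summable_log_div_rpow {s : ℝ} (hs : 1 < s) :
    Summable fun n : ℕ ↦ Real.log n / (n : ℝ) ^ s := by
  set e := (s - 1) / 2 with he
  have he0 : 0 < e := by rw [he]; linarith
  have h1 : Summable fun n : ℕ ↦ e⁻¹ * (1 / (n : ℝ) ^ (s - e)) :=
    (Real.summable_one_div_nat_rpow.mpr (by rw [he]; linarith)).mul_left _
  refine h1.of_nonneg_of_le
    (fun n ↦ div_nonneg (Real.log_natCast_nonneg n) (by positivity)) fun n ↦ ?_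
  rcases Nat.eq_zero_or_pos n with rfl | hn
  · simp only [Nat.cast_zero, Real.log_zero, zero_div]; positivity
  · have hn' : (0 : ℝ) < n := by exact_mod_cast hn
    calc Real.log n / (n : ℝ) ^ s ≤ ((n : ℝ) ^ e / e) / (n : ℝ) ^ s := by
          gcongr; exact Real.log_le_rpow_div hn'.le he0
      _ = e⁻¹ * (1 / (n : ℝ) ^ (s - e)) := by
          rw [Real.rpow_sub hn']; field_simp

lemma log_div_rpow_antitone {s x y : ℝ} (hs : 1 ≤ s) (hx : 3 ≤ x) (hxy : x ≤ y) :
    Real.log y / y ^ s ≤ Real.log x / x ^ s := by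
  have hx' : Real.exp s⁻¹ ≤ x := by
    refine (Real.exp_le_exp.mpr (inv_le_one_of_one_le₀ hs)).trans ?_
    linarith [Real.exp_one_lt_d9]
  exact Real.log_div_self_rpow_antitoneOn (by linarith) hx' (hx'.trans hxy) hxy

lemma log_three_add_log_five_lt : 5 * Real.log 3 + 3 * Real.log 5 ≤ 15 * Real.log 2 := by
  have h : Real.log ((3 : ℝ) ^ 5 * 5 ^ 3) ≤ Real.log ((2 : ℝ) ^ 15) :=
    Real.log_le_log (by norm_num) (by norm_num)
  rw [Real.log_mul (by norm_num) (by norm_num), Real.log_pow, Real.log_pow, Real.log_pow] at h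
  exact_mod_cast h

lemma log_four_terms_nonneg {u : ℝ} (hu : 0 ≤ u) :
    0 ≤ (Real.log 2 / (2 : ℝ) ^ (1 + u) - Real.log 3 / (3 : ℝ) ^ (1 + u)) +
      (Real.log 4 / (4 : ℝ) ^ (1 + u) - Real.log 5 / (5 : ℝ) ^ (1 + u)) := by
  have hlog4 : Real.log 4 = 2 * Real.log 2 := by
    rw [show (4 : ℝ) = 2 ^ 2 by norm_num, Real.log_pow]; norm_num
  have hlog2 : 0 < Real.log 2 := Real.log_pos (by norm_num)
  have hlog5 : 0 < Real.log 5 := Real.log_pos (by norm_num)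
  have hpow (a : ℝ) (ha : 0 < a) : ((3 : ℝ) / a) ^ (1 + u) = 3 / a * (3 / a) ^ u := by
    rw [Real.rpow_add (by positivity), Real.rpow_one]
  have hp : (1 : ℝ) ≤ (3 / 2) ^ u * (3 / 4) ^ u := by
    rw [← Real.mul_rpow (by norm_num) (by norm_num)]
    exact Real.one_le_rpow (by norm_num) hu
  have h5 : ((3 : ℝ) / 5) ^ u ≤ 1 := Real.rpow_le_one (by norm_num) (by norm_num) hu
  have hsum : (2 : ℝ) ≤ (3 / 2) ^ u + (3 / 4) ^ u := by
    have h2 : (0 : ℝ) < (3 / 2) ^ u := by positivity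
    have h4 : (0 : ℝ) < (3 / 4) ^ u := by positivity
    nlinarith [sq_nonneg (((3 : ℝ) / 2) ^ u - (3 / 4) ^ u)]
  have key : 0 ≤ Real.log 2 * (3 / 2 : ℝ) ^ (1 + u) - Real.log 3 +
      (Real.log 4 * (3 / 4 : ℝ) ^ (1 + u) - Real.log 5 * (3 / 5 : ℝ) ^ (1 + u)) := by
    rw [hpow 2 (by norm_num), hpow 4 (by norm_num), hpow 5 (by norm_num), hlog4]
    have := mul_le_mul_of_nonneg_left hsum hlog2.le
    have := mul_le_mul_of_nonneg_left h5 hlog5.le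
    linarith [log_three_add_log_five_lt]
  have h3 : (0 : ℝ) < 3 ^ (1 + u) := by positivity
  refine (div_nonneg key h3.le).trans_eq ?_
  rw [Real.div_rpow (by norm_num) (by norm_num), Real.div_rpow (by norm_num) (by norm_num),
    Real.div_rpow (by norm_num) (by norm_num)]
  field_simp

lemma tsum_log_div_rpow_odd_le_even {u : ℝ} (hu : 0 < u) :
    ∑' k : ℕ, Real.log (2 * k + 1 : ℕ) / ((2 * k + 1 : ℕ) : ℝ) ^ (1 + u) ≤
      ∑' k : ℕ, Real.log (2 * k : ℕ) / ((2 * k : ℕ) : ℝ) ^ (1 + u) := by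
  have hs := summable_log_div_rpow (show 1 < 1 + u by linarith)
  have he : Summable fun k : ℕ ↦ Real.log (2 * k : ℕ) / ((2 * k : ℕ) : ℝ) ^ (1 + u) :=
    hs.comp_injective (i := fun k : ℕ ↦ 2 * k) fun a b h ↦ by simpa using h
  have ho : Summable fun k : ℕ ↦ Real.log (2 * k + 1 : ℕ) / ((2 * k + 1 : ℕ) : ℝ) ^ (1 + u) :=
    hs.comp_injective (i := fun k : ℕ ↦ 2 * k + 1) fun a b h ↦ by simpa using h
  rw [← sub_nonneg, ← he.tsum_sub ho]
  refine le_trans ?_ ((he.sub ho).sum_le_tsum (Finset.range 3) fun k hk ↦ ?_)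
  · refine (log_four_terms_nonneg hu.le).trans_eq ?_
    norm_num [Finset.sum_range_succ]
    ring
  · have hk3 : 3 ≤ k := by simpa using hk
    refine sub_nonneg.mpr (log_div_rpow_antitone (by linarith) ?_ ?_)
    · exact_mod_cast (by omega : 3 ≤ 2 * k)
    · exact_mod_cast (by omega : 2 * k ≤ 2 * k + 1)

lemma tsum_log_div_rpow_even {s : ℝ} (hs : 1 < s) :
    ∑' k : ℕ, Real.log (2 * k : ℕ) / ((2 * k : ℕ) : ℝ) ^ s =
      (Real.log 2 * (∑' n : ℕ, 1 / (n : ℝ) ^ s) + ∑' n : ℕ, Real.log n / (n : ℝ) ^ s) /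
        (2 : ℝ) ^ s := by
  rw [← tsum_mul_left, ← ((Real.summable_one_div_nat_rpow.mpr hs).mul_left _).tsum_add
    (summable_log_div_rpow hs), ← tsum_div_const]
  refine tsum_congr fun k ↦ ?_
  rcases Nat.eq_zero_or_pos k with rfl | hk
  · simp [Real.zero_rpow (by linarith : s ≠ 0)]
  · have hk' : (0 : ℝ) < k := by exact_mod_cast hk
    push_cast
    rw [Real.log_mul (by norm_num) hk'.ne', Real.mul_rpow (by norm_num) hk'.le]
    field_simp

theorem vonMangoldt_dirichlet_series_bound (u : ℝ) (hu : 0 < u) :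
    (∑' q : ℕ, ArithmeticFunction.vonMangoldt q / (q : ℝ) ^ (1 + u)) ≤
        Real.log 2 / ((2 : ℝ) ^ u - 1) ∧
      Real.log 2 / ((2 : ℝ) ^ u - 1) ≤ 1 / u := by
  have hpos : 0 < (2 : ℝ) ^ u - 1 := sub_pos.mpr (Real.one_lt_rpow (by norm_num) hu)
  have hs : 1 < 1 + u := by linarith
  constructor
  · have hsum := summable_log_div_rpow hs
    have hzeta := Real.summable_one_div_nat_rpow.mpr hs
    have hsplit := tsum_even_add_odd (f := fun n : ℕ ↦ Real.log n / (n : ℝ) ^ (1 + u))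
      (hsum.comp_injective (i := fun k : ℕ ↦ 2 * k) fun a b h ↦ by simpa using h)
      (hsum.comp_injective (i := fun k : ℕ ↦ 2 * k + 1) fun a b h ↦ by simpa using h)
    have hle := tsum_log_div_rpow_odd_le_even hu
    have heven := tsum_log_div_rpow_even hs
    have hmul := tsum_vonMangoldt_mul_tsum_one hs
    have hZ : 0 < ∑' n : ℕ, 1 / (n : ℝ) ^ (1 + u) :=
      hzeta.tsum_pos (fun n ↦ by positivity) 1 (by simp)
    rw [Real.rpow_add (by norm_num) 1 u, Real.rpow_one, eq_div_iff (by positivity)] at heven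
    rw [le_div_iff₀ hpos]
    refine le_of_mul_le_mul_right ?_ hZ
    rw [mul_right_comm, hmul]
    have hscaled := mul_le_mul_of_nonneg_left hle (by positivity : (0 : ℝ) ≤ 2 ^ u)
    have hsplit' := congrArg ((2 : ℝ) ^ u * ·) hsplit
    simp only [mul_add] at hsplit'
    linarith
  · rw [div_le_div_iff₀ hpos hu, Real.rpow_def_of_pos (by norm_num)]
    linarith [Real.add_one_le_exp (Real.log 2 * u)]
end

section
/- There is an absolute constant $C$ such that for all reals $m \geq 1$ and $2 \leq y \leq z$, $\left| \sum_{y \leq q \leq z} \frac{\Lambda(q)}{q \log^2(mq)} - \left( \frac{1}{\log(my)} - \frac{1}{\log(mz)} \right) \right| \leq \frac{C}{\log^2(my)}$, where the sum is over natural numbers $q$ in $[y,z]$. -/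
open scoped Classical

open Finset ArithmeticFunction

namespace VonMangoldtSum

theorem sum_log_eq_log_factorial (N : ℕ) :
    ∑ n ∈ Ioc 0 N, Real.log n = Real.log (N.factorial : ℝ) := by
  induction N with
  | zero => simp
  | succ N ih =>
    rw [Finset.sum_Ioc_succ_top (Nat.zero_le N), ih, Nat.factorial_succ, Nat.cast_mul,
      Real.log_mul (by positivity) (by positivity), add_comm]

theorem log_factorial_eq_sum_vonMangoldt (N : ℕ) :
    Real.log (N.factorial : ℝ) = ∑ n ∈ Ioc 0 N, vonMangoldt n * ((N / n : ℕ) : ℝ) := by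
  rw [← sum_log_eq_log_factorial, ← sum_Ioc_mul_zeta_eq_sum, vonMangoldt_mul_zeta]
  simp [log_apply]

theorem log_factorial_le_mul_sum (N : ℕ) :
    Real.log (N.factorial : ℝ) ≤ N * ∑ n ∈ Ioc 0 N, vonMangoldt n / n := by
  rw [log_factorial_eq_sum_vonMangoldt, Finset.mul_sum]
  refine Finset.sum_le_sum fun n _ ↦ ?_
  calc vonMangoldt n * ((N / n : ℕ) : ℝ) ≤ vonMangoldt n * ((N : ℝ) / n) :=
        mul_le_mul_of_nonneg_left Nat.cast_div_le vonMangoldt_nonneg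
    _ = N * (vonMangoldt n / n) := by ring

theorem mul_sum_le_log_factorial_add_psi (N : ℕ) :
    N * ∑ n ∈ Ioc 0 N, vonMangoldt n / n ≤ Real.log (N.factorial : ℝ) + Chebyshev.psi N := by
  rw [log_factorial_eq_sum_vonMangoldt, Finset.mul_sum, Chebyshev.psi, Nat.floor_natCast,
    ← Finset.sum_add_distrib]
  refine Finset.sum_le_sum fun n hn ↦ ?_
  have hn0 : 0 < n := (Finset.mem_Ioc.mp hn).1
  have h : (N : ℝ) / n ≤ ((N / n : ℕ) : ℝ) + 1 := by
    rw [← Nat.floor_div_eq_div (K := ℝ)]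
    exact (Nat.lt_floor_add_one _).le
  calc (N : ℝ) * (vonMangoldt n / n) = vonMangoldt n * ((N : ℝ) / n) := by ring
    _ ≤ vonMangoldt n * (((N / n : ℕ) : ℝ) + 1) :=
        mul_le_mul_of_nonneg_left h vonMangoldt_nonneg
    _ = _ := by ring

/-- Mertens' estimate `∑ n ≤ N, Λ n / n = log N + O(1)`. -/
theorem abs_sum_vonMangoldt_div_sub_log_le {N : ℕ} (hN : 0 < N) :
    |∑ n ∈ Ioc 0 N, vonMangoldt n / n - Real.log N| ≤ Real.log 4 + 4 := by
  have hN' : (0 : ℝ) < N := by exact_mod_cast hN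
  have hlog4 : 0 < Real.log 4 := Real.log_pos (by norm_num)
  have hupper : Real.log (N.factorial : ℝ) ≤ N * Real.log N := by
    rw [← Real.log_pow]
    exact Real.log_le_log (by positivity) (by exact_mod_cast N.factorial_le_pow)
  have hlower : N * Real.log N - N ≤ Real.log (N.factorial : ℝ) := by
    have h := Real.log_le_log (by positivity) (Real.pow_div_factorial_le_exp _ hN'.le N)
    rw [Real.log_exp, Real.log_div (by positivity) (by positivity), Real.log_pow] at h
    linarith
  have h1 := log_factorial_le_mul_sum N
  have h2 := mul_sum_le_log_factorial_add_psi N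
  have h3 := Chebyshev.psi_le_const_mul_self hN'.le
  rw [abs_le]
  constructor <;> refine le_of_mul_le_mul_left ?_ hN' <;> nlinarith

/-- The error term in Mertens' estimate, with the sum taken over `k < n`. -/
noncomputable def mertensError (n : ℕ) : ℝ :=
  ∑ k ∈ range n, vonMangoldt k / k - Real.log n

theorem mertensError_succ_sub (n : ℕ) :
    mertensError (n + 1) - mertensError n =
      vonMangoldt n / n - (Real.log ((n + 1 : ℕ) : ℝ) - Real.log n) := by
  simp only [mertensError, Finset.sum_range_succ]
  ring

theorem log_succ_sub_log_le {n : ℕ} (hn : 0 < n) :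
    Real.log ((n + 1 : ℕ) : ℝ) - Real.log n ≤ 1 / n := by
  have hn' : (0 : ℝ) < n := by exact_mod_cast hn
  rw [← Real.log_div (by positivity) (by positivity)]
  refine (Real.log_le_sub_one_of_pos (by positivity)).trans (le_of_eq ?_)
  push_cast
  field_simp
  ring

theorem abs_mertensError_le {n : ℕ} (hn : 2 ≤ n) : |mertensError n| ≤ Real.log 4 + 5 := by
  obtain ⟨N, rfl⟩ : ∃ N, n = N + 1 := ⟨n - 1, by omega⟩
  have hN : 0 < N := by omega
  have hN1 : (1 : ℝ) ≤ N := by exact_mod_cast hN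
  have hsum : ∑ k ∈ range (N + 1), vonMangoldt k / (k : ℝ) =
      ∑ k ∈ Ioc 0 N, vonMangoldt k / (k : ℝ) := by
    rw [Finset.range_eq_Ico, ← Finset.sum_Ioo_add_eq_sum_Ico (by omega)]
    simp only [CharP.cast_eq_zero, div_zero, add_zero]
    congr 1
  have h1 := abs_le.mp (abs_sum_vonMangoldt_div_sub_log_le hN)
  have h2 := log_succ_sub_log_le hN
  have h3 : (1 : ℝ) / N ≤ 1 := by rw [div_le_one (by linarith)]; exact hN1
  have h4 : Real.log N ≤ Real.log ((N + 1 : ℕ) : ℝ) :=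
    Real.log_le_log (by linarith) (by push_cast; linarith)
  rw [mertensError, hsum, abs_le]
  constructor <;> linarith [h1.1, h1.2]

/-- Summation by parts against a bounded function, for a nonnegative antitone weight. -/
theorem abs_sum_mul_sub_le_of_antitone {f r : ℕ → ℝ} {a n : ℕ} {K : ℝ} (han : a ≤ n)
    (hf : ∀ k, a ≤ k → 0 ≤ f k) (hanti : ∀ k, a ≤ k → f (k + 1) ≤ f k)
    (hr : ∀ k, a ≤ k → |r k| ≤ K) :
    |∑ q ∈ Ico a n, f q * (r (q + 1) - r q)| ≤ 2 * K * f a := by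
  have key : |∑ q ∈ Ico a n, f q * (r (q + 1) - r q) - f n * r n + f a * r a| ≤
      K * (f a - f n) := by
    induction n, han using Nat.le_induction with
    | base => simp
    | succ n han ih =>
      rw [Finset.sum_Ico_succ_top han]
      have h1 : |(f n - f (n + 1)) * r (n + 1)| ≤ K * (f n - f (n + 1)) := by
        have h0 : 0 ≤ f n - f (n + 1) := sub_nonneg.mpr (hanti n han)
        rw [abs_mul, abs_of_nonneg h0, mul_comm]
        exact mul_le_mul_of_nonneg_right (hr _ (by omega)) h0
      rw [abs_le] at ih h1 ⊢
      constructor <;> linarith [ih.1, ih.2, h1.1, h1.2]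
  have bound : ∀ k, a ≤ k → |f k * r k| ≤ K * f k := fun k hk ↦ by
    rw [abs_mul, abs_of_nonneg (hf k hk), mul_comm]
    exact mul_le_mul_of_nonneg_right (hr k hk) (hf k hk)
  have ha := abs_le.mp (bound a le_rfl)
  have hn := abs_le.mp (bound n han)
  rw [abs_le] at key ⊢
  constructor <;> linarith [key.1, key.2, ha.1, ha.2, hn.1, hn.2]

theorem one_le_log_mul {m x : ℝ} (hm : 1 ≤ m) (hx : 3 ≤ x) : 1 ≤ Real.log (m * x) := by
  rw [Real.le_log_iff_exp_le (by nlinarith)]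
  nlinarith [Real.exp_one_lt_d9]

theorem log_mul_pos {m x : ℝ} (hm : 1 ≤ m) (hx : 2 ≤ x) : 0 < Real.log (m * x) :=
  Real.log_pos (by nlinarith)

theorem log_mul_le_log_mul {m x y : ℝ} (hm : 1 ≤ m) (hx : 2 ≤ x) (hxy : x ≤ y) :
    Real.log (m * x) ≤ Real.log (m * y) :=
  Real.log_le_log (by nlinarith) (by nlinarith)

theorem log_mul_sub_log_mul {m x y : ℝ} (hm : 1 ≤ m) (hx : 2 ≤ x) (hy : 2 ≤ y) :
    Real.log (m * y) - Real.log (m * x) = Real.log y - Real.log x := by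
  rw [Real.log_mul (by linarith) (by linarith), Real.log_mul (by linarith) (by linarith)]
  ring

/-- The sum of `(log (q + 1) - log q) / log² (m q)` is close to the telescoping sum of
`1 / log (m q) - 1 / log (m (q + 1))`. -/
theorem abs_sum_log_sub_div_sq_sub_le {m : ℝ} (hm : 1 ≤ m) {a n : ℕ} (ha : 2 ≤ a) (han : a ≤ n) :
    |∑ q ∈ Ico a n, 1 / Real.log (m * q) ^ 2 * (Real.log ((q + 1 : ℕ) : ℝ) - Real.log q) -
      (1 / Real.log (m * a) - 1 / Real.log (m * n))| ≤ 1 / Real.log (m * a) ^ 2 := by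
  have ha' : (2 : ℝ) ≤ a := by exact_mod_cast ha
  have hLa := log_mul_pos hm ha'
  suffices h : |∑ q ∈ Ico a n,
      1 / Real.log (m * q) ^ 2 * (Real.log ((q + 1 : ℕ) : ℝ) - Real.log q) -
      (1 / Real.log (m * a) - 1 / Real.log (m * n))| ≤
      1 / Real.log (m * a) ^ 2 * (1 / ((a : ℝ) - 1) - 1 / ((n : ℝ) - 1)) by
    refine h.trans (mul_le_of_le_one_right (by positivity) ?_)
    have h1 : 1 / ((a : ℝ) - 1) ≤ 1 := by
      rw [div_le_one (by linarith)]; linarith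
    have han' : (a : ℝ) ≤ n := by exact_mod_cast han
    have h2 : 0 ≤ 1 / ((n : ℝ) - 1) := one_div_nonneg.mpr (by linarith)
    linarith
  induction n, han using Nat.le_induction with
  | base => simp
  | succ n han ih =>
    rw [Finset.sum_Ico_succ_top han]
    have han' : (a : ℝ) ≤ n := by exact_mod_cast han
    have hn : (2 : ℝ) ≤ n := ha'.trans han'
    have hcast : ((n + 1 : ℕ) : ℝ) = n + 1 := by push_cast; rfl
    have hD := log_succ_sub_log_le (n := n) (by omega)
    rw [← log_mul_sub_log_mul hm hn (by rw [hcast]; linarith)] at hD ⊢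
    have hmono := log_mul_le_log_mul (y := ((n + 1 : ℕ) : ℝ)) hm hn (by rw [hcast]; linarith)
    have hL' := one_le_log_mul (x := ((n + 1 : ℕ) : ℝ)) hm (by rw [hcast]; linarith)
    have hLan := log_mul_le_log_mul hm ha' han'
    set L := Real.log (m * n)
    set L' := Real.log (m * ((n + 1 : ℕ) : ℝ))
    set La := Real.log (m * a)
    have hL : 0 < L := hLa.trans_le hLan
    have hL'pos : 0 < L' := by linarith
    have hterm : 1 / L ^ 2 * (L' - L) - (1 / L - 1 / L') = 1 / L ^ 2 * ((L' - L) ^ 2 / L') := by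
      field_simp
    have hnonneg : 0 ≤ 1 / L ^ 2 * ((L' - L) ^ 2 / L') := by positivity
    have hle : 1 / L ^ 2 * ((L' - L) ^ 2 / L') ≤
        1 / La ^ 2 * (1 / ((n : ℝ) - 1) - 1 / (((n + 1 : ℕ) : ℝ) - 1)) := by
      have h1 : (L' - L) ^ 2 / L' ≤ 1 / ((n : ℝ) - 1) - 1 / (((n + 1 : ℕ) : ℝ) - 1) := by
        calc (L' - L) ^ 2 / L' ≤ (L' - L) ^ 2 := div_le_self (by positivity) hL'
          _ ≤ (1 / (n : ℝ)) ^ 2 := pow_le_pow_left₀ (by linarith) hD 2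
          _ ≤ 1 / (((n : ℝ) - 1) * n) := by
            rw [div_pow, one_pow]
            exact one_div_le_one_div_of_le (by nlinarith) (by nlinarith)
          _ = _ := by
            rw [hcast, add_sub_cancel_right]
            have : (n : ℝ) - 1 ≠ 0 := by linarith
            have : (n : ℝ) ≠ 0 := by linarith
            field_simp
            ring
      exact mul_le_mul (one_div_le_one_div_of_le (by positivity)
        (pow_le_pow_left₀ hLa.le hLan 2)) h1 (by positivity) (by positivity)
    rw [abs_le] at ih ⊢
    constructor <;> linarith [ih.1, ih.2]

theorem abs_one_div_log_mul_sub_le {m x y : ℝ} (hm : 1 ≤ m) (hx : 2 ≤ x) (hxy : x ≤ y)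
    (hyx : y ≤ x + 1) :
    |1 / Real.log (m * x) - 1 / Real.log (m * y)| ≤ 1 / Real.log (m * x) ^ 2 := by
  have hLx := log_mul_pos hm hx
  have hmono := log_mul_le_log_mul hm hx hxy
  have hdiff : Real.log (m * y) - Real.log (m * x) ≤ 1 := by
    rw [log_mul_sub_log_mul hm hx (hx.trans hxy), ← Real.log_div (by linarith) (by linarith)]
    refine (Real.log_le_sub_one_of_pos (div_pos (by linarith) (by linarith))).trans ?_
    rw [sub_le_iff_le_add, div_le_iff₀ (by linarith)]
    linarith
  have hLy := hLx.trans_le hmono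
  rw [abs_of_nonneg (sub_nonneg.mpr (one_div_le_one_div_of_le hLx hmono)),
    div_sub_div _ _ hLx.ne' hLy.ne', one_mul, mul_one]
  exact div_le_div₀ zero_le_one hdiff (by positivity) (by nlinarith)

theorem tsum_eq_sum_Ico (g : ℕ → ℝ) (y : ℝ) {z : ℝ} (hz : 0 ≤ z) :
    (∑' q : ℕ, if y ≤ (q : ℝ) ∧ (q : ℝ) ≤ z then g q else 0) =
      ∑ q ∈ Ico ⌈y⌉₊ (⌊z⌋₊ + 1), g q := by
  have hmem : ∀ q : ℕ, q ∈ Ico ⌈y⌉₊ (⌊z⌋₊ + 1) ↔ y ≤ (q : ℝ) ∧ (q : ℝ) ≤ z := fun q ↦ by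
    rw [Finset.mem_Ico, Nat.ceil_le, Nat.lt_succ_iff, Nat.le_floor_iff hz]
  rw [tsum_eq_sum (s := Ico ⌈y⌉₊ (⌊z⌋₊ + 1)) fun q hq ↦ if_neg fun h ↦ hq ((hmem q).mpr h)]
  exact Finset.sum_congr rfl fun q hq ↦ if_pos ((hmem q).mp hq)

theorem abs_sum_Ico_vonMangoldt_sub_le {m : ℝ} (hm : 1 ≤ m) {a n : ℕ} (ha : 2 ≤ a)
    (han : a ≤ n) :
    |∑ q ∈ Ico a n, vonMangoldt q / ((q : ℝ) * Real.log (m * q) ^ 2) -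
      (1 / Real.log (m * a) - 1 / Real.log (m * n))| ≤
      (2 * (Real.log 4 + 5) + 1) * (1 / Real.log (m * a) ^ 2) := by
  have hsum : ∑ q ∈ Ico a n, vonMangoldt q / ((q : ℝ) * Real.log (m * q) ^ 2) =
      ∑ q ∈ Ico a n, 1 / Real.log (m * q) ^ 2 * (mertensError (q + 1) - mertensError q) +
      ∑ q ∈ Ico a n, 1 / Real.log (m * q) ^ 2 * (Real.log ((q + 1 : ℕ) : ℝ) - Real.log q) := by
    rw [← Finset.sum_add_distrib]
    refine Finset.sum_congr rfl fun q _ ↦ ?_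
    rw [mertensError_succ_sub, ← mul_add, sub_add_cancel, div_mul_div_comm, one_mul,
      mul_comm (q : ℝ)]
  have h1 := abs_sum_mul_sub_le_of_antitone (f := fun q ↦ 1 / Real.log (m * q) ^ 2)
    (r := mertensError) (K := Real.log 4 + 5) han (fun k _ ↦ by positivity)
    (fun k hk ↦ by
      have hk' : (2 : ℝ) ≤ k := by exact_mod_cast ha.trans hk
      have hpos := log_mul_pos hm hk'
      exact one_div_le_one_div_of_le (by positivity)
        (pow_le_pow_left₀ hpos.le (log_mul_le_log_mul hm hk' (by push_cast; linarith)) 2))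
    (fun k hk ↦ abs_mertensError_le (ha.trans hk))
  have h2 := abs_sum_log_sub_div_sq_sub_le hm ha han
  rw [hsum, add_sub_assoc]
  refine (abs_add_le _ _).trans ((add_le_add h1 h2).trans (le_of_eq ?_))
  ring

end VonMangoldtSum

open VonMangoldtSum

theorem vonMangoldt_partial_sum_asymptotic :
    ∃ C : ℝ, ∀ m y z : ℝ, 1 ≤ m → 2 ≤ y → y ≤ z →
      |(∑' q : ℕ, if y ≤ (q : ℝ) ∧ (q : ℝ) ≤ z then
            ArithmeticFunction.vonMangoldt q / ((q : ℝ) * (Real.log (m * q)) ^ 2) else 0) -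
          (1 / Real.log (m * y) - 1 / Real.log (m * z))| ≤ C / (Real.log (m * y)) ^ 2 := by
  refine ⟨2 * (Real.log 4 + 5) + 3, fun m y z hm hy hyz ↦ ?_⟩
  have hz : 2 ≤ z := hy.trans hyz
  rw [tsum_eq_sum_Ico (fun q ↦ vonMangoldt q / ((q : ℝ) * (Real.log (m * q)) ^ 2)) y
    (by linarith)]
  have hya : y ≤ (⌈y⌉₊ : ℝ) := Nat.le_ceil y
  have hay : (⌈y⌉₊ : ℝ) ≤ y + 1 := (Nat.ceil_lt_add_one (by linarith)).le
  have hzn : z ≤ ((⌊z⌋₊ + 1 : ℕ) : ℝ) := by push_cast; exact (Nat.lt_floor_add_one z).le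
  have hnz : ((⌊z⌋₊ + 1 : ℕ) : ℝ) ≤ z + 1 := by
    push_cast; linarith [Nat.floor_le (show 0 ≤ z by linarith)]
  have ha : 2 ≤ ⌈y⌉₊ := by exact_mod_cast hy.trans hya
  have han : ⌈y⌉₊ ≤ ⌊z⌋₊ + 1 := Nat.ceil_le.mpr (hyz.trans hzn)
  have h1 := abs_sum_Ico_vonMangoldt_sub_le hm ha han
  have h2 := abs_one_div_log_mul_sub_le hm hy hya hay
  have h3 := abs_one_div_log_mul_sub_le hm hz hzn hnz
  have hpos := log_mul_pos hm hy
  have inv_sq_le : ∀ x, y ≤ x → 1 / Real.log (m * x) ^ 2 ≤ 1 / Real.log (m * y) ^ 2 :=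
    fun x hx ↦ one_div_le_one_div_of_le (by positivity)
      (pow_le_pow_left₀ hpos.le (log_mul_le_log_mul hm hy hx) 2)
  have h1' := h1.trans (mul_le_mul_of_nonneg_left (inv_sq_le _ hya)
    (by linarith [Real.log_pos (show (1 : ℝ) < 4 by norm_num)]))
  have h3' := h3.trans (inv_sq_le z hyz)
  rw [div_eq_mul_one_div (2 * (Real.log 4 + 5) + 3)]
  rw [abs_le] at h1' h2 h3' ⊢
  constructor <;> linarith [h1'.1, h1'.2, h2.1, h2.2, h3'.1, h3'.2]
end

section
/- There is an absolute constant $C$ such that for all reals $m \geq 1$ and $y \geq 2$, $\left| \sum_{q \geq y} \frac{\Lambda(q)}{q \log^2(mq)} - \frac{1}{\log(my)} \right| \leq \frac{C}{\log^2(my)}$, where the sum is over natural numbers $q \geq y$. -/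
open scoped Classical

open Finset Filter Topology

open ArithmeticFunction in
/-- Counting the multiples of each `d ≤ n` expresses `log n!` through the von Mangoldt function. -/
lemma sum_vonMangoldt_mul_div_eq_log_factorial (n : ℕ) :
    ∑ d ∈ Ioc 0 n, vonMangoldt d * ((n / d : ℕ) : ℝ) = Real.log (n.factorial : ℝ) := by
  rw [← sum_Ioc_mul_zeta_eq_sum vonMangoldt n, vonMangoldt_mul_zeta]
  induction n with
  | zero => simp
  | succ n ih =>
    rw [sum_Ioc_succ_top (Nat.zero_le n), ih, Nat.factorial_succ, Nat.cast_mul,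
      Real.log_mul (by positivity) (by positivity), ArithmeticFunction.log_apply, add_comm]

lemma mul_log_sub_le_log_factorial {n : ℕ} (hn : 1 ≤ n) :
    n * Real.log n - n ≤ Real.log (n.factorial : ℝ) := by
  have hn' : (0 : ℝ) < n := by exact_mod_cast hn
  have h := Real.log_le_log (by positivity) (Real.pow_div_factorial_le_exp n hn'.le n)
  rw [Real.log_exp, Real.log_div (by positivity) (by positivity), Real.log_pow] at h
  linarith

lemma log_factorial_le_mul_log {n : ℕ} :
    Real.log (n.factorial : ℝ) ≤ n * Real.log n := by
  rw [← Real.log_pow]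
  exact Real.log_le_log (by positivity) (by exact_mod_cast n.factorial_le_pow)

/-- Mertens' first theorem for the von Mangoldt function. -/
theorem abs_sum_vonMangoldt_div_sub_log_le {n : ℕ} (hn : 1 ≤ n) :
    |∑ q ∈ Ioc 0 n, ArithmeticFunction.vonMangoldt q / (q : ℝ) - Real.log n|
      ≤ Real.log 4 + 4 := by
  have hn' : (0 : ℝ) < n := by exact_mod_cast hn
  have hlog4 : 0 ≤ Real.log 4 := Real.log_nonneg (by norm_num)
  set A := ∑ q ∈ Ioc 0 n, ArithmeticFunction.vonMangoldt q / (q : ℝ)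
  have hmul : n * A = ∑ q ∈ Ioc 0 n, ArithmeticFunction.vonMangoldt q * ((n : ℝ) / q) := by
    rw [mul_sum]
    exact sum_congr rfl fun q _ => by ring
  have hlower : Real.log (n.factorial : ℝ) ≤ n * A := by
    rw [hmul, ← sum_vonMangoldt_mul_div_eq_log_factorial]
    gcongr
    exact Nat.cast_div_le
  have hupper : n * A ≤ Real.log (n.factorial : ℝ) + Chebyshev.psi n := by
    rw [hmul, ← sum_vonMangoldt_mul_div_eq_log_factorial, Chebyshev.psi, Nat.floor_natCast,
      ← sum_add_distrib]
    refine sum_le_sum fun q _ => ?_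
    have hdiv : (n : ℝ) / q ≤ ((n / q : ℕ) : ℝ) + 1 := by
      rw [← Nat.floor_div_eq_div (K := ℝ)]
      exact (Nat.lt_floor_add_one _).le
    have := mul_le_mul_of_nonneg_left hdiv (ArithmeticFunction.vonMangoldt_nonneg (n := q))
    linarith
  have hpsi := Chebyshev.psi_le_const_mul_self hn'.le
  have h₁ := mul_log_sub_le_log_factorial hn
  have h₂ := log_factorial_le_mul_log (n := n)
  rw [abs_le]
  constructor <;> refine le_of_mul_le_mul_left ?_ hn' <;> nlinarith

/-- The increment of `log` over `[a, b]`, weighted by the value of `1 / log ^ 2` at the right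
endpoint, compared with the increment of `-1 / log`. Here `s` and `t` are the logarithms of the
endpoints. -/
lemma abs_sub_mul_inv_sq_sub_le {s t : ℝ} (hs : 0 < s) (hst : s ≤ t) (hts : t ≤ s + 1) :
    |(t - s) * (t ^ 2)⁻¹ - (s⁻¹ - t⁻¹)| ≤ (s ^ 2)⁻¹ - (t ^ 2)⁻¹ := by
  have ht : 0 < t := hs.trans_le hst
  have heq : (t - s) * (t ^ 2)⁻¹ - (s⁻¹ - t⁻¹) = -((t - s) ^ 2 * s) / (s ^ 2 * t ^ 2) := by
    field_simp
    ring
  have heq' : (s ^ 2)⁻¹ - (t ^ 2)⁻¹ = (t - s) * (t + s) / (s ^ 2 * t ^ 2) := by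
    field_simp
    ring
  rw [heq, heq', abs_div, abs_neg, abs_of_nonneg (by positivity), abs_of_pos (by positivity)]
  gcongr <;> nlinarith

/-- Summation by parts. If the partial sums of `a` are `l + R` with `|R| ≤ K` and `l` positive,
nondecreasing and with steps at most `1` from `N` on, then the sums of `a / l ^ 2` agree with the
increments of `-1 / l` up to `O((l N)⁻²)`. -/
lemma abs_sum_mul_inv_sq_sub_le {a l R : ℕ → ℝ} {K : ℝ} {N : ℕ} (ha : |a N| ≤ 1)
    (hl : ∀ n, N ≤ n → 0 < l n) (hmono : ∀ n, N ≤ n → l n ≤ l (n + 1))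
    (hstep : ∀ n, N ≤ n → l (n + 1) ≤ l n + 1) (hR : ∀ n, N ≤ n → |R n| ≤ K)
    (hpartial : ∀ n, N ≤ n → a (n + 1) = l (n + 1) - l n + (R (n + 1) - R n)) (k : ℕ) :
    |∑ q ∈ Ico N (N + k + 1), a q * (l q ^ 2)⁻¹ - ((l N)⁻¹ - (l (N + k))⁻¹)|
      ≤ (2 * K + 2) * (l N ^ 2)⁻¹ := by
  have hK : 0 ≤ K := (abs_nonneg _).trans (hR N le_rfl)
  have key : |∑ q ∈ Ico N (N + k + 1), a q * (l q ^ 2)⁻¹ - ((l N)⁻¹ - (l (N + k))⁻¹)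
      - R (N + k) * (l (N + k) ^ 2)⁻¹ + R N * (l N ^ 2)⁻¹|
      ≤ (K + 1) * ((l N ^ 2)⁻¹ - (l (N + k) ^ 2)⁻¹) + (l N ^ 2)⁻¹ := by
    induction k with
    | zero =>
      have h0 : (0 : ℝ) ≤ (l N ^ 2)⁻¹ := by positivity
      simpa [abs_mul, abs_of_nonneg h0] using mul_le_mul_of_nonneg_right ha h0
    | succ k ih =>
      have hk : N ≤ N + k := Nat.le_add_right N k
      have hmain := abs_sub_mul_inv_sq_sub_le (hl _ hk) (hmono _ hk) (hstep _ hk)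
      have hd : 0 ≤ (l (N + k) ^ 2)⁻¹ - (l (N + k + 1) ^ 2)⁻¹ := (abs_nonneg _).trans hmain
      have hRk : |R (N + k) * ((l (N + k) ^ 2)⁻¹ - (l (N + k + 1) ^ 2)⁻¹)|
          ≤ K * ((l (N + k) ^ 2)⁻¹ - (l (N + k + 1) ^ 2)⁻¹) := by
        rw [abs_mul, abs_of_nonneg hd]
        exact mul_le_mul_of_nonneg_right (hR _ hk) hd
      rw [← add_assoc, sum_Ico_succ_top (by lia), hpartial _ hk]
      rw [abs_le] at ih hmain hRk ⊢
      constructor <;> linarith [ih.1, ih.2, hmain.1, hmain.2, hRk.1, hRk.2]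
  have hbound : ∀ n, N ≤ n → |R n * (l n ^ 2)⁻¹| ≤ K * (l n ^ 2)⁻¹ := fun n hn => by
    have h0 : (0 : ℝ) ≤ (l n ^ 2)⁻¹ := by positivity
    rw [abs_mul, abs_of_nonneg h0]
    exact mul_le_mul_of_nonneg_right (hR n hn) h0
  have h₁ := hbound N le_rfl
  have h₂ := hbound (N + k) (Nat.le_add_right N k)
  have h₃ : (0 : ℝ) ≤ (l (N + k) ^ 2)⁻¹ := by positivity
  rw [abs_le] at key h₁ h₂ ⊢
  constructor <;> linarith [key.1, key.2, h₁.1, h₁.2, h₂.1, h₂.2]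

lemma log_mul_sub_log_mul_le {m x y : ℝ} (hm : 0 < m) (hx : 1 ≤ x) (hy : 0 < y)
    (hyx : y ≤ x + 1) : Real.log (m * y) ≤ Real.log (m * x) + 1 := by
  have hx' : 0 < x := by linarith
  rw [Real.log_mul hm.ne' hy.ne', Real.log_mul hm.ne' hx'.ne']
  have h := Real.log_le_sub_one_of_pos (div_pos hy hx')
  rw [Real.log_div hy.ne' hx'.ne'] at h
  have : y / x ≤ 2 := by
    rw [div_le_iff₀ hx']
    linarith
  linarith

lemma vonMangoldt_div_le_one (q : ℕ) : |ArithmeticFunction.vonMangoldt q / (q : ℝ)| ≤ 1 := by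
  have h0 : 0 ≤ ArithmeticFunction.vonMangoldt q / (q : ℝ) :=
    div_nonneg ArithmeticFunction.vonMangoldt_nonneg q.cast_nonneg
  rw [abs_of_nonneg h0]
  exact div_le_one_of_le₀
    (ArithmeticFunction.vonMangoldt_le_log.trans (Real.log_le_self q.cast_nonneg)) q.cast_nonneg

/-- Finite sections of the tail starting at an integer. -/
lemma abs_sum_Ico_vonMangoldt_sub_le {m : ℝ} (hm : 1 ≤ m) {N : ℕ} (hN : 2 ≤ N) (k : ℕ) :
    |∑ q ∈ Ico N (N + k + 1),
        ArithmeticFunction.vonMangoldt q / ((q : ℝ) * (Real.log (m * q)) ^ 2) -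
      ((Real.log (m * N))⁻¹ - (Real.log (m * (N + k : ℕ)))⁻¹)|
      ≤ (2 * (Real.log 4 + 4) + 2) * (Real.log (m * N) ^ 2)⁻¹ := by
  have hcast : ∀ n : ℕ, N ≤ n → (2 : ℝ) ≤ n := fun n hn => by exact_mod_cast hN.trans hn
  have hm0 : 0 < m := by linarith
  have h := abs_sum_mul_inv_sq_sub_le (N := N) (K := Real.log 4 + 4)
    (a := fun q => ArithmeticFunction.vonMangoldt q / (q : ℝ))
    (l := fun q => Real.log (m * q))
    (R := fun n => ∑ q ∈ Ioc 0 n, ArithmeticFunction.vonMangoldt q / (q : ℝ) - Real.log n)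
    (vonMangoldt_div_le_one N)
    (fun n hn => Real.log_pos (by nlinarith [hcast n hn]))
    (fun n hn => by
      have := hcast n hn
      exact Real.log_le_log (by positivity) (by gcongr; exact n.le_succ))
    (fun n hn => log_mul_sub_log_mul_le hm0 (by linarith [hcast n hn]) (by positivity) (by simp))
    (fun n hn => abs_sum_vonMangoldt_div_sub_log_le (by lia))
    (fun n hn => by
      have := hcast n hn
      rw [sum_Ioc_succ_top (Nat.zero_le n), Real.log_mul hm0.ne' (by positivity),
        Real.log_mul hm0.ne' (by positivity)]
      ring) k
  simpa only [div_mul_eq_div_div, div_eq_mul_inv, mul_inv, mul_assoc] using h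

/-- The infinite tail starting at an integer. -/
lemma abs_tsum_vonMangoldt_sub_le {m : ℝ} (hm : 1 ≤ m) {N : ℕ} (hN : 2 ≤ N) {u : ℕ → ℝ}
    (hlt : ∀ q, q < N → u q = 0)
    (hle : ∀ q, N ≤ q →
      u q = ArithmeticFunction.vonMangoldt q / ((q : ℝ) * (Real.log (m * q)) ^ 2)) :
    |∑' q, u q - (Real.log (m * N))⁻¹|
      ≤ (2 * (Real.log 4 + 4) + 2) * (Real.log (m * N) ^ 2)⁻¹ := by
  have hm0 : 0 < m := by linarith
  have hsum : ∀ k, ∑ q ∈ range (N + k + 1), u q = ∑ q ∈ Ico N (N + k + 1),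
      ArithmeticFunction.vonMangoldt q / ((q : ℝ) * (Real.log (m * q)) ^ 2) := fun k => by
    rw [← sum_range_add_sum_Ico u (show N ≤ N + k + 1 by lia),
      sum_eq_zero fun q hq => hlt q (mem_range.1 hq), zero_add]
    exact sum_congr rfl fun q hq => hle q (mem_Ico.1 hq).1
  have hfin : ∀ k, |∑ q ∈ range (N + k + 1), u q -
      ((Real.log (m * N))⁻¹ - (Real.log (m * (N + k : ℕ)))⁻¹)|
      ≤ (2 * (Real.log 4 + 4) + 2) * (Real.log (m * N) ^ 2)⁻¹ := fun k => by
    rw [hsum]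
    exact abs_sum_Ico_vonMangoldt_sub_le hm hN k
  have hnonneg : ∀ q, 0 ≤ u q := fun q => by
    rcases lt_or_ge q N with h | h
    · rw [hlt q h]
    · rw [hle q h]
      exact div_nonneg ArithmeticFunction.vonMangoldt_nonneg (by positivity)
  have hsummable : Summable u := by
    refine summable_of_sum_range_le (c := (Real.log (m * N))⁻¹ +
      (2 * (Real.log 4 + 4) + 2) * (Real.log (m * N) ^ 2)⁻¹) hnonneg fun n => ?_
    have hmono : ∑ q ∈ range n, u q ≤ ∑ q ∈ range (N + n + 1), u q :=
      sum_le_sum_of_subset_of_nonneg (range_subset_range.2 (by lia)) fun q _ _ => hnonneg q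
    have hpos : 0 ≤ (Real.log (m * (N + n : ℕ)))⁻¹ := by
      have : (2 : ℝ) ≤ (N + n : ℕ) := by exact_mod_cast hN.trans (Nat.le_add_right N n)
      exact inv_nonneg.2 (Real.log_nonneg (by nlinarith))
    linarith [(abs_le.1 (hfin n)).2]
  have hlog : Tendsto (fun k : ℕ => (Real.log (m * (N + k : ℕ)))⁻¹) atTop (𝓝 0) := by
    refine tendsto_inv_atTop_zero.comp (Real.tendsto_log_atTop.comp
      (Tendsto.const_mul_atTop hm0 (tendsto_natCast_atTop_atTop.comp ?_)))
    exact tendsto_atTop_mono (fun k => Nat.le_add_left k N) tendsto_id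
  have hpart : Tendsto (fun k => ∑ q ∈ range (N + k + 1), u q) atTop (𝓝 (∑' q, u q)) :=
    hsummable.hasSum.tendsto_sum_nat.comp
      (tendsto_atTop_mono (fun k => show k ≤ N + k + 1 by lia) tendsto_id)
  have hlim := (hpart.sub (hlog.const_sub (Real.log (m * N))⁻¹)).abs
  rw [sub_zero] at hlim
  exact le_of_tendsto' hlim hfin

theorem vonMangoldt_tail_sum_asymptotic :
    ∃ C : ℝ, ∀ m y : ℝ, 1 ≤ m → 2 ≤ y →
      |(∑' q : ℕ, if y ≤ (q : ℝ) then
            ArithmeticFunction.vonMangoldt q / ((q : ℝ) * (Real.log (m * q)) ^ 2) else 0) -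
          1 / Real.log (m * y)| ≤ C / (Real.log (m * y)) ^ 2 := by
  refine ⟨2 * (Real.log 4 + 4) + 3, fun m y hm hy => ?_⟩
  have hyN : y ≤ (⌈y⌉₊ : ℕ) := Nat.le_ceil y
  have hN : 2 ≤ ⌈y⌉₊ := by exact_mod_cast hy.trans hyN
  have htail := abs_tsum_vonMangoldt_sub_le hm hN
    (u := fun q : ℕ => if y ≤ (q : ℝ) then
      ArithmeticFunction.vonMangoldt q / ((q : ℝ) * (Real.log (m * q)) ^ 2) else 0)
    (fun q hq => if_neg (not_le.2 (Nat.lt_ceil.1 hq)))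
    (fun q hq => if_pos (Nat.ceil_le.1 hq))
  have hlog4 : 0 ≤ Real.log 4 := Real.log_nonneg (by norm_num)
  have hs : 0 < Real.log (m * y) := Real.log_pos (by nlinarith)
  have hst : Real.log (m * y) ≤ Real.log (m * (⌈y⌉₊ : ℕ)) :=
    Real.log_le_log (by positivity) (by gcongr)
  have hts : Real.log (m * (⌈y⌉₊ : ℕ)) ≤ Real.log (m * y) + 1 :=
    log_mul_sub_log_mul_le (by linarith) (by linarith) (by linarith)
      (Nat.ceil_lt_add_one (by linarith)).le
  set s := Real.log (m * y)
  set t := Real.log (m * (⌈y⌉₊ : ℕ))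
  have ht : 0 < t := hs.trans_le hst
  have hsq : (t ^ 2)⁻¹ ≤ (s ^ 2)⁻¹ := by gcongr
  have hinv : t⁻¹ ≤ s⁻¹ := by gcongr
  have hdiff : s⁻¹ - t⁻¹ ≤ (s ^ 2)⁻¹ := by
    rw [inv_sub_inv hs.ne' ht.ne', div_le_iff₀ (by positivity), sq, mul_inv]
    field_simp
    nlinarith
  have hmul := mul_le_mul_of_nonneg_left hsq (show 0 ≤ 2 * (Real.log 4 + 4) + 2 by positivity)
  rw [one_div, div_eq_mul_inv]
  rw [abs_le] at htail ⊢
  constructor <;> linarith [htail.1, htail.2]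
end
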